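/- arXiv:1610.06610 — 6 statements merged into one kernel-verified Lean document; each statement's English description precedes it below -/
import Mathlib

section
/- Let n ≥ 2 and let d, a be positive integers. Define S = {q : q divides d and n ∉ Γ(d/q)}. If a lies in the numerical semigroup generated by S (i.e., a is a finite sum of elements of S), then the triple (n,d,a) is good. -/
open MvPolynomial

/-- A sequence of polynomials is a regular sequence if each element is a
nonzerodivisor modulo the ideal generated by the previous ones. -/
def RegSeq {n : ℕ} (fs : List (MvPolynomial (Fin n) ℂ)) : Prop :=
  ∀ i : Fin fs.length, ∀ g : MvPolynomial (Fin n) ℂ,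
    g * fs.get i ∈ Ideal.span {p | p ∈ fs.take i.1} →
    g ∈ Ideal.span {p | p ∈ fs.take i.1}

/-- The sequence `x_1^d - x_n^d, …, x_{n-1}^d - x_n^d` in `ℂ[x_1,…,x_n]`. -/
noncomputable def powDiffSeq (n d : ℕ) : List (MvPolynomial (Fin n) ℂ) :=
  (List.finRange (n - 1)).map fun i =>
    X (⟨i.1, by have := i.isLt; omega⟩ : Fin n) ^ d -
    X (⟨n - 1, by have := i.isLt; omega⟩ : Fin n) ^ d

/-- The triple `(n,d,a)` is good if there is a homogeneous symmetric polynomial `f`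
of degree `a` such that `x_1^d - x_n^d, …, x_{n-1}^d - x_n^d, f` is a regular
sequence. -/
def GoodTriple (n d a : ℕ) : Prop :=
  ∃ f : MvPolynomial (Fin n) ℂ, f.IsHomogeneous a ∧ f.IsSymmetric ∧
    RegSeq (powDiffSeq n d ++ [f])

/-- `Γ(m)`: the numerical semigroup generated by the prime divisors of `m`. -/
def Gamma (m : ℕ) : AddSubmonoid ℕ :=
  AddSubmonoid.closure {p : ℕ | p.Prime ∧ p ∣ m}

open scoped IntermediateField

theorem IntermediateField.eq_zero_of_sum_pow_mul_eq_zero {K : IntermediateField ℚ ℂ} {x : ℂ}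
    {N : ℕ} (hN : N ≤ (minpoly K x).natDegree) (c : ℕ → ℂ) (hc : ∀ i, c i ∈ K)
    (hsum : ∑ i ∈ Finset.range N, x ^ i * c i = 0) : ∀ i < N, c i = 0 := by
  classical
  set P : Polynomial K := ∑ i ∈ Finset.range N, Polynomial.monomial i (⟨c i, hc i⟩ : K) with hP
  have haeval : Polynomial.aeval x P = 0 := by
    rw [hP, map_sum, ← hsum]
    refine Finset.sum_congr rfl fun i _ => ?_
    rw [Polynomial.aeval_monomial, mul_comm]
    rfl
  have hdeg : P.degree < N := by
    rw [← Polynomial.mem_degreeLT, hP]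
    refine Submodule.sum_mem _ fun i hi => ?_
    rw [Polynomial.mem_degreeLT]
    exact (Polynomial.degree_monomial_le _ _).trans_lt (by exact_mod_cast Finset.mem_range.1 hi)
  have hP0 : P = 0 := by
    by_contra hne
    have h1 := minpoly.degree_le_of_ne_zero K x hne haeval
    have h2 := Polynomial.natDegree_le_natDegree h1
    have h3 := (Polynomial.natDegree_lt_iff_degree_lt hne).2 hdeg
    omega
  intro i hi
  have hcoeff : P.coeff i = ⟨c i, hc i⟩ := by
    simp [hP, Polynomial.finsetSum_coeff, Polynomial.coeff_monomial, hi]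
  rw [hP0, Polynomial.coeff_zero] at hcoeff
  exact (congrArg Subtype.val hcoeff).symm

theorem IsPrimitiveRoot.totient_le_natDegree_minpoly_mul {θ x w : ℂ} {k m : ℕ} (hk : 0 < k)
    (hm : 0 < m) (hθ : IsPrimitiveRoot θ k) (hw : IsPrimitiveRoot w m)
    (hx : IsIntegral ℚ⟮θ⟯ x) (hwx : w ∈ (ℚ⟮θ⟯)⟮x⟯) :
    m.totient ≤ (minpoly ℚ⟮θ⟯ x).natDegree * k.totient := by
  have hθi : IsIntegral ℚ θ := (hθ.isIntegral hk).tower_top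
  have h1 : Module.finrank ℚ ℚ⟮θ⟯ = k.totient := by
    rw [IntermediateField.adjoin.finrank hθi, ← Polynomial.cyclotomic_eq_minpoly_rat hθ hk,
      Polynomial.natDegree_cyclotomic]
  have : FiniteDimensional ℚ ℚ⟮θ⟯ := IntermediateField.adjoin.finiteDimensional hθi
  have : FiniteDimensional ℚ⟮θ⟯ (ℚ⟮θ⟯)⟮x⟯ := IntermediateField.adjoin.finiteDimensional hx
  have : FiniteDimensional ℚ (ℚ⟮θ⟯)⟮x⟯ := Module.Finite.trans ℚ⟮θ⟯ _
  have h2 := Module.finrank_mul_finrank ℚ ℚ⟮θ⟯ (ℚ⟮θ⟯)⟮x⟯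
  have h3 := minpoly.natDegree_le (A := ℚ) (⟨w, hwx⟩ : (ℚ⟮θ⟯)⟮x⟯)
  have hw' : IsPrimitiveRoot (⟨w, hwx⟩ : (ℚ⟮θ⟯)⟮x⟯) m := by
    refine IsPrimitiveRoot.of_map_of_injective (f := algebraMap (ℚ⟮θ⟯)⟮x⟯ ℂ) ?_
      (algebraMap (ℚ⟮θ⟯)⟮x⟯ ℂ).injective
    exact hw
  rw [← Polynomial.cyclotomic_eq_minpoly_rat hw' hm, Polynomial.natDegree_cyclotomic, ← h2,
    h1, IntermediateField.adjoin.finrank hx] at h3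
  linarith [mul_comm (minpoly ℚ⟮θ⟯ x).natDegree k.totient]

theorem IsPrimitiveRoot.multiset_sum_mem_adjoin {θ : ℂ} {k : ℕ} (hk : 0 < k)
    (hθ : IsPrimitiveRoot θ k) {s : Multiset ℂ} (hs : ∀ z ∈ s, z ^ k = 1) : s.sum ∈ ℚ⟮θ⟯ := by
  have : NeZero k := ⟨hk.ne'⟩
  refine multiset_sum_mem _ fun z hz => ?_
  obtain ⟨i, _, rfl⟩ := hθ.eq_pow_of_pow_eq_one (hs z hz)
  exact pow_mem (IntermediateField.mem_adjoin_simple_self ℚ θ) i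

theorem IsPrimitiveRoot.eq_zero_of_sum_pow_mul_eq_zero {p k : ℕ} (hp : p.Prime) (hk : 0 < k)
    (hpk : p ∣ k) {ζ : ℂ} (hζ : IsPrimitiveRoot ζ (p * k)) (c : ℕ → ℂ)
    (hc : ∀ i, c i ∈ ℚ⟮ζ ^ p⟯) (hsum : ∑ i ∈ Finset.range p, ζ ^ i * c i = 0) :
    ∀ i < p, c i = 0 := by
  have hm : 0 < p * k := Nat.mul_pos hp.pos hk
  refine IntermediateField.eq_zero_of_sum_pow_mul_eq_zero ?_ c hc hsum
  have h := IsPrimitiveRoot.totient_le_natDegree_minpoly_mul hk hm (hζ.pow hm rfl) hζ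
    (hζ.isIntegral hm).tower_top (IntermediateField.mem_adjoin_simple_self _ ζ)
  rw [Nat.totient_mul_of_prime_of_dvd hp hpk] at h
  exact Nat.le_of_mul_le_mul_right h (Nat.totient_pos.2 hk)

theorem IsPrimitiveRoot.eq_of_sum_pow_mul_eq_zero {p k : ℕ} (hp : p.Prime) (hk : 0 < k)
    (hpk : ¬ p ∣ k) {η θ : ℂ} (hη : IsPrimitiveRoot η p) (hθ : IsPrimitiveRoot θ k) (c : ℕ → ℂ)
    (hc : ∀ i, c i ∈ ℚ⟮θ⟯) (hsum : ∑ i ∈ Finset.range p, η ^ i * c i = 0) :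
    ∀ i < p, ∀ j < p, c i = c j := by
  have hw : IsPrimitiveRoot (η * θ) (p * k) := by
    have := (Commute.all η θ).orderOf_mul_eq_mul_orderOf_of_coprime
      (by rw [← hη.eq_orderOf, ← hθ.eq_orderOf]; exact (Nat.Prime.coprime_iff_not_dvd hp).2 hpk)
    rw [← hη.eq_orderOf, ← hθ.eq_orderOf] at this
    exact this ▸ IsPrimitiveRoot.orderOf _
  have hdeg : p - 1 ≤ (minpoly ℚ⟮θ⟯ η).natDegree := by
    have h := IsPrimitiveRoot.totient_le_natDegree_minpoly_mul hk (Nat.mul_pos hp.pos hk) hθ hw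
      (hη.isIntegral hp.pos).tower_top
      (mul_mem (IntermediateField.mem_adjoin_simple_self _ η)
        (IntermediateField.algebraMap_mem _
          (⟨θ, IntermediateField.mem_adjoin_simple_self ℚ θ⟩ : ℚ⟮θ⟯)))
    rw [Nat.totient_mul_of_prime_of_not_dvd hp hpk] at h
    exact Nat.le_of_mul_le_mul_right h (Nat.totient_pos.2 hk)
  have key := IntermediateField.eq_zero_of_sum_pow_mul_eq_zero hdeg (fun i => c i - c (p - 1))
    (fun i => sub_mem (hc i) (hc _)) (by
      have hgeom := hη.geom_sum_eq_zero hp.one_lt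
      have hsplit : ∑ i ∈ Finset.range p, η ^ i * (c i - c (p - 1)) = 0 := by
        simp only [mul_sub, Finset.sum_sub_distrib, hsum, ← Finset.sum_mul, hgeom, zero_mul,
          sub_zero]
      obtain ⟨q, rfl⟩ : ∃ q, p = q + 1 := ⟨p - 1, by have := hp.pos; omega⟩
      simpa [Finset.sum_range_succ] using hsplit)
  have hlast : ∀ i < p, c i = c (p - 1) := by
    intro i hi
    rcases Nat.lt_or_ge i (p - 1) with h | h
    · exact sub_eq_zero.1 (key i h)
    · rw [show i = p - 1 by omega]
  exact fun i hi j hj => (hlast i hi).trans (hlast j hj).symm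

theorem Multiset.exists_decomposition_of_roots {p k : ℕ} (ξ : ℕ → ℂ) (s : Multiset ℂ)
    (hs : ∀ z ∈ s, ∃ i < p, ∃ w : ℂ, w ^ k = 1 ∧ z = ξ i * w) :
    ∃ S : ℕ → Multiset ℂ, (∀ i, ∀ z ∈ S i, z ^ k = 1) ∧
      s.card = ∑ i ∈ Finset.range p, (S i).card ∧
      s.sum = ∑ i ∈ Finset.range p, ξ i * (S i).sum := by
  induction s using Multiset.induction_on with
  | empty => exact ⟨fun _ => 0, by simp, by simp, by simp⟩
  | cons z s ih =>
    obtain ⟨S, hS, hcard, hsum⟩ := ih fun y hy => hs y (Multiset.mem_cons_of_mem hy)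
    obtain ⟨j, hj, w, hw, rfl⟩ := hs z (Multiset.mem_cons_self z s)
    refine ⟨fun i => (if i = j then {w} else 0) + S i, fun i y hy => ?_, ?_, ?_⟩
    · rcases Multiset.mem_add.1 hy with h | h
      · split_ifs at h
        · rwa [Multiset.mem_singleton.1 h]
        · simp at h
      · exact hS i y h
    · simp [Finset.sum_add_distrib, hcard, apply_ite Multiset.card, hj, add_comm]
    · simp [Finset.sum_add_distrib, hsum, apply_ite Multiset.sum, hj, mul_add]

theorem exists_eq_pow_mul_of_pow_mul_eq_one {p k : ℕ} (hp : 0 < p) (hk : 0 < k) {ζ : ℂ}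
    (hζ : IsPrimitiveRoot ζ (p * k)) {z : ℂ} (hz : z ^ (p * k) = 1) :
    ∃ i < p, ∃ w : ℂ, w ^ k = 1 ∧ z = ζ ^ i * w := by
  have : NeZero (p * k) := ⟨(Nat.mul_pos hp hk).ne'⟩
  obtain ⟨e, _, rfl⟩ := hζ.eq_pow_of_pow_eq_one hz
  refine ⟨e % p, Nat.mod_lt _ hp, ζ ^ (p * (e / p)), ?_, ?_⟩
  · rw [← pow_mul, mul_right_comm, pow_mul, hζ.pow_eq_one, one_pow]
  · rw [← pow_add, Nat.mod_add_div]

theorem exists_eq_pow_mul_of_coprime {p k : ℕ} (hpk : p.Coprime k) (hp : 0 < p) (hk : 0 < k)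
    {η : ℂ} (hη : IsPrimitiveRoot η p) {z : ℂ} (hz : z ^ (p * k) = 1) :
    ∃ i < p, ∃ w : ℂ, w ^ k = 1 ∧ z = η ^ i * w := by
  have : NeZero p := ⟨hp.ne'⟩
  have hz0 : z ≠ 0 := by
    rintro rfl
    simp [hp.ne', hk.ne'] at hz
  obtain ⟨i, hi, hiz⟩ := hη.eq_pow_of_pow_eq_one
    (ξ := (z ^ (k : ℤ)) ^ (p.gcdB k)) (by
      rw [← zpow_natCast, ← zpow_mul, ← zpow_mul, mul_left_comm, mul_comm (k : ℤ),
        mul_comm (p.gcdB k), zpow_mul, ← Nat.cast_mul, zpow_natCast, hz, one_zpow])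
  refine ⟨i, hi, (z ^ (p : ℤ)) ^ (p.gcdA k), ?_, ?_⟩
  · rw [← zpow_natCast, ← zpow_mul, ← zpow_mul, mul_comm (p.gcdA k), ← mul_assoc,
      zpow_mul, ← Nat.cast_mul, zpow_natCast, hz, one_zpow]
  · rw [hiz, ← zpow_mul, ← zpow_mul, ← zpow_add₀ hz0, add_comm, ← Nat.gcd_eq_gcd_ab, hpk]
    simp

theorem Gamma_mono {k m : ℕ} (h : k ∣ m) : Gamma k ≤ Gamma m :=
  AddSubmonoid.closure_mono fun _ hq => ⟨hq.1, hq.2.trans h⟩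

theorem mem_Gamma_of_prime {p m : ℕ} (hp : p.Prime) (h : p ∣ m) : p ∈ Gamma m :=
  AddSubmonoid.subset_closure ⟨hp, h⟩

theorem Multiset.sum_eq_card_of_pow_one {s : Multiset ℂ} (hs : ∀ z ∈ s, z ^ 1 = 1) :
    s.sum = s.card := by
  have h := Multiset.eq_replicate_card.2 fun z hz => (pow_one z).symm.trans (hs z hz)
  rw [h]
  simp

theorem le_sum_of_dichotomy {A B p l : ℤ} {N i : ℕ} {κ τ : ℕ → ℤ} (hAB : A < B)
    (hBp : B ≤ p) (hpN : p = N) (hκ : ∀ j, 0 ≤ κ j) (hl : 0 ≤ l)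
    (hkA : ∑ j ∈ Finset.range N, κ j < A) (hi : i < N)
    (hτ : ∀ j < N, l * (1 - κ j) ≤ τ j) (hτi : (A - (κ i + l)) * (B - 1) ≤ τ i) :
    (A - ∑ j ∈ Finset.range N, κ j) * (B - 1) ≤ ∑ j ∈ Finset.range N, τ j := by
  have himem : i ∈ Finset.range N := Finset.mem_range.2 hi
  have hall : l * (p - ∑ j ∈ Finset.range N, κ j) ≤ ∑ j ∈ Finset.range N, τ j := by
    calc _ = ∑ j ∈ Finset.range N, l * (1 - κ j) := by
          rw [← Finset.mul_sum, Finset.sum_sub_distrib]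
          simp [hpN]
      _ ≤ _ := Finset.sum_le_sum fun j hj => hτ j (Finset.mem_range.1 hj)
  have hothers : l * (p - 1 - (∑ j ∈ Finset.range N, κ j - κ i)) + τ i ≤
      ∑ j ∈ Finset.range N, τ j := by
    rw [← Finset.sum_erase_add _ _ himem, ← Finset.sum_erase_add (a := i) _ τ himem]
    gcongr
    calc _ = ∑ j ∈ (Finset.range N).erase i, l * (1 - κ j) := by
          rw [← Finset.mul_sum, Finset.sum_sub_distrib]
          have h1 : ((N - 1 : ℕ) : ℤ) = p - 1 := by rw [hpN]; push_cast [show 1 ≤ N by omega]; ring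
          simp [Finset.card_erase_of_mem himem, h1]
      _ ≤ _ := Finset.sum_le_sum fun j hj =>
          hτ j (Finset.mem_range.1 (Finset.mem_of_mem_erase hj))
  have hκi : κ i ≤ ∑ j ∈ Finset.range N, κ j :=
    Finset.single_le_sum (fun j _ => hκ j) himem
  have hκ0 : 0 ≤ ∑ j ∈ Finset.range N, κ j := Finset.sum_nonneg fun j _ => hκ j
  set k := ∑ j ∈ Finset.range N, κ j
  rcases le_or_gt l (B - 1) with h | h
  · nlinarith [mul_nonneg (sub_nonneg.2 h) (sub_nonneg.2 hκi), mul_nonneg hl (sub_nonneg.2 hBp)]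
  · nlinarith [mul_nonneg hl (sub_nonneg.2 hBp),
      mul_nonneg (sub_nonneg.2 (Int.le_of_lt h)) (show 0 ≤ B - k by linarith),
      mul_nonneg (show 0 ≤ B - A by linarith) (show 0 ≤ B - 1 by linarith [hκ i])]

/-- For multisets `s`, `t` of `m`-th roots of unity with equal sums, either `t` exceeds `s` in size
by an element of `Γ(m)`, or `t` is large compared to the two smallest prime divisors of `m`. -/
theorem card_dichotomy_of_sum_eq {A B : ℕ} (hAB : A < B) (m : ℕ) (hm : 0 < m)
    (hprime : ∀ p : ℕ, p.Prime → p ∣ m → p = A ∨ B ≤ p) (s t : Multiset ℂ)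
    (hs : ∀ z ∈ s, z ^ m = 1) (ht : ∀ z ∈ t, z ^ m = 1) (hst : s.sum = t.sum) :
    (∃ g ∈ Gamma m, t.card = s.card + g) ∨
      ((A : ℤ) - s.card) * ((B : ℤ) - 1) ≤ t.card := by
  induction m using Nat.strong_induction_on generalizing s t with
  | _ m ih =>
  rcases Nat.lt_or_ge s.card A with hkA | hkA
  swap
  · right
    exact (mul_nonpos_of_nonpos_of_nonneg (by omega) (by omega)).trans (by omega)
  by_cases hm1 : m = 1
  · subst hm1
    rw [Multiset.sum_eq_card_of_pow_one hs, Multiset.sum_eq_card_of_pow_one ht] at hst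
    exact Or.inl ⟨0, zero_mem _, by exact_mod_cast hst.symm⟩
  obtain ⟨p, hp, hpm, hpA⟩ : ∃ p : ℕ, p.Prime ∧ p ∣ m ∧
      (p = A → ∀ q : ℕ, q.Prime → q ∣ m → q = A) := by
    by_cases h : ∃ p : ℕ, p.Prime ∧ p ∣ m ∧ p ≠ A
    · obtain ⟨p, hp, hpm, hpA⟩ := h
      exact ⟨p, hp, hpm, fun h => absurd h hpA⟩
    · push Not at h
      obtain ⟨p, hp, hpm⟩ := Nat.exists_prime_and_dvd hm1
      exact ⟨p, hp, hpm, fun _ => h⟩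
  obtain ⟨k, rfl⟩ := hpm
  have hk : 0 < k := Nat.pos_of_mul_pos_left hm
  have hkm : k < p * k := by nlinarith [hp.two_le]
  have hprime' : ∀ q : ℕ, q.Prime → q ∣ k → q = A ∨ B ≤ q :=
    fun q hq hqk => hprime q hq (hqk.mul_left p)
  have hAp : A ≤ p := by
    rcases hprime p hp (dvd_mul_right p k) with h | h <;> omega
  have hmono : Gamma k ≤ Gamma (p * k) := Gamma_mono (dvd_mul_left k p)
  by_cases hpk : p ∣ k
  · have hζ := Complex.isPrimitiveRoot_exp (p * k) hm.ne'
    set ζ := Complex.exp (2 * Real.pi * Complex.I / (p * k : ℕ))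
    obtain ⟨S, hS, hScard, hSsum⟩ := Multiset.exists_decomposition_of_roots (p := p) (ζ ^ ·) s
      fun z hz => exists_eq_pow_mul_of_pow_mul_eq_one hp.pos hk hζ (hs z hz)
    obtain ⟨T, hT, hTcard, hTsum⟩ := Multiset.exists_decomposition_of_roots (p := p) (ζ ^ ·) t
      fun z hz => exists_eq_pow_mul_of_pow_mul_eq_one hp.pos hk hζ (ht z hz)
    have hθ := hζ.pow hm rfl
    have heq := IsPrimitiveRoot.eq_zero_of_sum_pow_mul_eq_zero hp hk hpk hζ
      (fun i => (S i).sum - (T i).sum)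
      (fun i => sub_mem (hθ.multiset_sum_mem_adjoin hk (hS i))
        (hθ.multiset_sum_mem_adjoin hk (hT i)))
      (by simp only [mul_sub, Finset.sum_sub_distrib]; rw [← hSsum, ← hTsum, hst, sub_self])
    by_cases hnice : ∀ i < p, ∃ g ∈ Gamma k, (T i).card = (S i).card + g
    · choose! g hg hgT using hnice
      refine Or.inl ⟨∑ i ∈ Finset.range p, g i,
        sum_mem fun i hi => hmono (hg i (Finset.mem_range.1 hi)), ?_⟩
      rw [hScard, hTcard, ← Finset.sum_add_distrib]
      exact Finset.sum_congr rfl fun i hi => hgT i (Finset.mem_range.1 hi)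
    · push Not at hnice
      obtain ⟨i, hi, hbad⟩ := hnice
      right
      rcases ih k hkm hk hprime' (S i) (T i) (hS i) (hT i) (sub_eq_zero.1 (heq i hi)) with h | h
      · obtain ⟨g, hg, h⟩ := h
        exact absurd h (hbad g hg)
      · have h1 : (S i).card ≤ s.card := hScard ▸ Finset.single_le_sum
          (f := fun j => (S j).card) (fun _ _ => Nat.zero_le _) (Finset.mem_range.2 hi)
        have h2 : (T i).card ≤ t.card := hTcard ▸ Finset.single_le_sum
          (f := fun j => (T j).card) (fun _ _ => Nat.zero_le _) (Finset.mem_range.2 hi)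
        have h3 : ((A : ℤ) - s.card) * ((B : ℤ) - 1) ≤ (A - (S i).card) * ((B : ℤ) - 1) :=
          mul_le_mul_of_nonneg_right (by omega) (by omega)
        omega
  · have hη := Complex.isPrimitiveRoot_exp p hp.ne_zero
    have hθ := Complex.isPrimitiveRoot_exp k hk.ne'
    set η := Complex.exp (2 * Real.pi * Complex.I / p)
    have hcop : p.Coprime k := (Nat.Prime.coprime_iff_not_dvd hp).2 hpk
    obtain ⟨S, hS, hScard, hSsum⟩ := Multiset.exists_decomposition_of_roots (p := p) (η ^ ·) s
      fun z hz => exists_eq_pow_mul_of_coprime hcop hp.pos hk hη (hs z hz)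
    obtain ⟨T, hT, hTcard, hTsum⟩ := Multiset.exists_decomposition_of_roots (p := p) (η ^ ·) t
      fun z hz => exists_eq_pow_mul_of_coprime hcop hp.pos hk hη (ht z hz)
    have heq := IsPrimitiveRoot.eq_of_sum_pow_mul_eq_zero hp hk hpk hη hθ
      (fun i => (T i).sum - (S i).sum)
      (fun i => sub_mem (hθ.multiset_sum_mem_adjoin hk (hT i))
        (hθ.multiset_sum_mem_adjoin hk (hS i)))
      (by simp only [mul_sub, Finset.sum_sub_distrib]; rw [← hSsum, ← hTsum, hst, sub_self])
    have hne : ((Finset.range p).filter fun j => S j = 0).Nonempty := by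
      by_contra hempty
      rw [Finset.not_nonempty_iff_eq_empty, Finset.filter_eq_empty_iff] at hempty
      have : ∑ i ∈ Finset.range p, 1 ≤ ∑ i ∈ Finset.range p, (S i).card :=
        Finset.sum_le_sum fun i hi => Multiset.card_pos.2 (hempty hi)
      simp at this
      omega
    obtain ⟨j, hj, hjmin⟩ := Finset.exists_min_image _ (fun j => (T j).card) hne
    obtain ⟨hjp, hSj⟩ := Finset.mem_filter.1 hj
    rw [Finset.mem_range] at hjp
    have hsum : ∀ i < p, (S i + T j).sum = (T i).sum := by
      intro i hi
      have h := heq i hi j hjp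
      rw [hSj, Multiset.sum_zero, sub_zero] at h
      rw [Multiset.sum_add, ← h]
      ring
    have hSTj : ∀ i, ∀ z ∈ S i + T j, z ^ k = 1 := fun i z hz =>
      (Multiset.mem_add.1 hz).elim (hS i z) (hT j z)
    have hdich : ∀ i < p, (∃ g ∈ Gamma k, (T i).card = (S i + T j).card + g) ∨
        ((A : ℤ) - (S i + T j).card) * ((B : ℤ) - 1) ≤ (T i).card := fun i hi =>
      ih k hkm hk hprime' _ _ (hSTj i) (hT i) (hsum i hi)
    by_cases hnice : ∀ i < p, ∃ g ∈ Gamma k, (T i).card = (S i + T j).card + g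
    · choose! g hg hgT using hnice
      refine Or.inl ⟨∑ i ∈ Finset.range p, g i + (T j).card • p,
        add_mem (sum_mem fun i hi => hmono (hg i (Finset.mem_range.1 hi)))
          (nsmul_mem (mem_Gamma_of_prime hp (dvd_mul_right p k)) _), ?_⟩
      rw [hScard, hTcard, Finset.sum_congr rfl fun i hi => hgT i (Finset.mem_range.1 hi)]
      simp only [Multiset.card_add, Finset.sum_add_distrib, Finset.sum_const, Finset.card_range,
        smul_eq_mul]
      ring
    · push Not at hnice
      obtain ⟨i, hi, hbad⟩ := hnice
      right
      have hBp : B ≤ p := by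
        rcases hprime p hp (dvd_mul_right p k) with h | h
        swap
        · exact h
        exfalso
        obtain rfl : k = 1 := by
          by_contra hk1
          obtain ⟨q, hq, hqk⟩ := Nat.exists_prime_and_dvd hk1
          have := hpA h q hq (hqk.mul_left p)
          exact hpk (by rwa [h, ← this])
        have h1 := hsum i hi
        rw [Multiset.sum_eq_card_of_pow_one (hSTj i), Multiset.sum_eq_card_of_pow_one (hT i)] at h1
        exact hbad 0 (zero_mem _) (by exact_mod_cast h1.symm)
      have hbig := (hdich i hi).resolve_left fun ⟨g, hg, h⟩ => hbad g hg h
      have hscard : (s.card : ℤ) = ∑ j ∈ Finset.range p, ((S j).card : ℤ) := by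
        exact_mod_cast hScard
      have htcard : (t.card : ℤ) = ∑ j ∈ Finset.range p, ((T j).card : ℤ) := by
        exact_mod_cast hTcard
      rw [hscard, htcard]
      refine le_sum_of_dichotomy (p := p) (l := (T j).card) (i := i) (by exact_mod_cast hAB)
        (by exact_mod_cast hBp) rfl (fun _ => by positivity) (by positivity)
        (by rw [← hscard]; exact_mod_cast hkA) hi (fun j' hj' => ?_)
        (by simpa [Multiset.card_add] using hbig)
      by_cases h0 : S j' = 0
      · have := hjmin j' (Finset.mem_filter.2 ⟨Finset.mem_range.2 hj', h0⟩)
        simpa [h0] using this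
      · have h1 : 0 < (S j').card := Multiset.card_pos.2 h0
        exact (mul_nonpos_of_nonneg_of_nonpos (by positivity) (by omega)).trans (by positivity)

/-- **Lam–Leung theorem**: the number of terms in a vanishing sum of `m`-th roots of unity lies in
the numerical semigroup generated by the prime divisors of `m`. -/
theorem card_mem_Gamma_of_sum_eq_zero {m : ℕ} (hm : 0 < m) (t : Multiset ℂ)
    (ht : ∀ z ∈ t, z ^ m = 1) (hsum : t.sum = 0) : t.card ∈ Gamma m := by
  classical
  by_cases hm1 : m = 1
  · subst hm1
    rw [Multiset.sum_eq_card_of_pow_one ht] at hsum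
    rw [Nat.cast_eq_zero.1 hsum]
    exact zero_mem _
  have hA : m.minFac.Prime := Nat.minFac_prime hm1
  have hnice : ∀ g ∈ Gamma m, t.card = (0 : Multiset ℂ).card + g → t.card ∈ Gamma m := by
    intro g hg h
    rw [h]
    simpa using hg
  by_cases h : ∃ q : ℕ, q.Prime ∧ q ∣ m ∧ q ≠ m.minFac
  · obtain ⟨hq, hqm, hqA⟩ := Nat.find_spec h
    set q := Nat.find h with hqdef
    have hlt : m.minFac < q := lt_of_le_of_ne (Nat.minFac_le_of_dvd hq.two_le hqm) hqA.symm
    rcases card_dichotomy_of_sum_eq hlt m hm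
      (fun p hp hpm => or_iff_not_imp_left.2 fun hpA => Nat.find_min' h ⟨hp, hpm, hpA⟩)
      0 t (by simp) ht (by simp [hsum]) with ⟨g, hg, hgt⟩ | hbig
    · exact hnice g hg hgt
    · have hle : (m.minFac - 1) * (q - 1) ≤ t.card := by
        zify [hA.one_le, hq.one_le]
        have h1 : (0 : ℤ) ≤ (q : ℤ) - 1 := by have := hq.one_le; omega
        rw [Multiset.card_zero] at hbig
        push_cast at hbig
        linarith
      obtain ⟨a, b, hab⟩ := Nat.exists_add_mul_eq_of_gcd_dvd_of_mul_pred_le m.minFac q t.card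
        (by rw [(Nat.coprime_primes hA hq).2 hqA.symm]; exact one_dvd _)
        (by simpa [Nat.pred_eq_sub_one] using hle)
      rw [← hab]
      exact add_mem (nsmul_mem (mem_Gamma_of_prime hA (Nat.minFac_dvd m)) a)
        (nsmul_mem (mem_Gamma_of_prime hq hqm) b)
  · push Not at h
    rcases card_dichotomy_of_sum_eq (A := m.minFac) (B := m.minFac + t.card + 2) (by omega) m hm
      (fun p hp hpm => Or.inl (h p hp hpm)) 0 t (by simp) ht (by simp [hsum]) with
      ⟨g, hg, hgt⟩ | hbig
    · exact hnice g hg hgt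
    · exfalso
      have h2 := hA.two_le
      rw [Multiset.card_zero] at hbig
      push_cast at hbig
      nlinarith

theorem mem_span_pow_sub_pow {n d : ℕ} (hd : 0 < d) (l : Fin n) (J : Finset (Fin n))
    (g : MvPolynomial (Fin n) ℂ)
    (hg : ∀ w : Fin n → ℂ, (∀ i, w i ^ d = 1) →
      aeval (fun i => if i ∈ J then C (w i) * X l else X i : Fin n → MvPolynomial (Fin n) ℂ) g
        = 0) :
    g ∈ Ideal.span ((fun j : Fin n => (X j ^ d - X l ^ d : MvPolynomial (Fin n) ℂ)) '' J) := by
  classical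
  have hζ := Complex.isPrimitiveRoot_exp d hd.ne'
  have hζR : IsPrimitiveRoot
      (C (Complex.exp (2 * Real.pi * Complex.I / d)) : MvPolynomial (Fin n) ℂ) d :=
    hζ.map_of_injective (f := (C : ℂ →+* MvPolynomial (Fin n) ℂ)) (C_injective _ _)
  set T : Finset (MvPolynomial (Fin n) ℂ) := Polynomial.nthRootsFinset d 1 with hT
  have hTmem : ∀ r ∈ T, ∃ u : ℂ, u ^ d = 1 ∧ r = C u := by
    intro r hr
    have : NeZero d := ⟨hd.ne'⟩
    obtain ⟨i, _, rfl⟩ := hζR.eq_pow_of_pow_eq_one ((Polynomial.mem_nthRootsFinset hd 1).1 hr)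
    exact ⟨_ ^ i, by rw [pow_right_comm, hζ.pow_eq_one, one_pow], by rw [C_pow]⟩
  set S : Fin n → Finset (MvPolynomial (Fin n) ℂ) := fun i =>
    if i ∈ J then T.image (fun r => r * X l) else {X i} with hS
  have hSne : ∀ i, (S i).Nonempty := by
    intro i
    simp only [hS]
    split_ifs
    · exact ⟨1 * X l, Finset.mem_image_of_mem _ ((Polynomial.mem_nthRootsFinset hd 1).2 (by simp))⟩
    · exact Finset.singleton_nonempty _
  obtain ⟨h, -, hh⟩ := combinatorial_nullstellensatz_exists_linearCombination S hSne
    (map (C : ℂ →+* MvPolynomial (Fin n) ℂ) g) (by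
      intro x hx
      have hw : ∀ i, ∃ u : ℂ, u ^ d = 1 ∧ (i ∈ J → x i = C u * X l) := by
        intro i
        by_cases hi : i ∈ J
        · have := hx i
          simp only [hS, hi, if_true, Finset.mem_image] at this
          obtain ⟨r, hr, hrx⟩ := this
          obtain ⟨u, hu, rfl⟩ := hTmem r hr
          exact ⟨u, hu, fun _ => hrx.symm⟩
        · exact ⟨1, one_pow d, fun h => absurd h hi⟩
      choose w hw1 hw2 using hw
      rw [eval_map, ← hg w hw1, aeval_def]
      congr 1
      funext i
      by_cases hi : i ∈ J
      · rw [if_pos hi, hw2 i hi]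
      · have := hx i
        simp only [hS, hi, if_false, Finset.mem_singleton] at this
        rw [if_neg hi, this])
  have hev := congrArg (eval (X : Fin n → MvPolynomial (Fin n) ℂ)) hh
  have hgg : eval (X : Fin n → MvPolynomial (Fin n) ℂ)
      (map (C : ℂ →+* MvPolynomial (Fin n) ℂ) g) = g := by
    rw [eval_map]
    exact eval₂_eta g
  rw [hgg, Finsupp.linearCombination_apply, Finsupp.sum, map_sum] at hev
  rw [hev]
  refine Ideal.sum_mem _ fun j _ => ?_
  rw [smul_eq_mul, map_mul]
  refine Ideal.mul_mem_left _ _ ?_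
  simp only [map_prod, map_sub, eval_X, eval_C]
  by_cases hj : j ∈ J
  · refine Ideal.subset_span ⟨j, hj, ?_⟩
    have hl0 : (X l : MvPolynomial (Fin n) ℂ) ≠ 0 := X_ne_zero l
    simp only [hS, hj, if_true]
    rw [Finset.prod_image (fun a _ b _ hab => mul_right_cancel₀ hl0 hab)]
    exact hζR.pow_sub_pow_eq_prod_sub_mul _ _ hd
  · simp [hS, hj]

theorem aeval_eq_zero_of_mem_span_pow_sub_pow {n d : ℕ} (l : Fin n) (J : Finset (Fin n))
    (hl : l ∉ J) (g : MvPolynomial (Fin n) ℂ)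
    (hg : g ∈ Ideal.span ((fun j : Fin n => (X j ^ d - X l ^ d : MvPolynomial (Fin n) ℂ)) '' J))
    (w : Fin n → ℂ) (hw : ∀ i, w i ^ d = 1) :
    aeval (fun i => if i ∈ J then C (w i) * X l else X i : Fin n → MvPolynomial (Fin n) ℂ) g
      = 0 := by
  have hle : Ideal.span ((fun j : Fin n => (X j ^ d - X l ^ d : MvPolynomial (Fin n) ℂ)) '' J) ≤
      RingHom.ker (aeval (R := ℂ)
        (fun i => if i ∈ J then C (w i) * X l else X i : Fin n → MvPolynomial (Fin n) ℂ)) := by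
    rw [Ideal.span_le]
    rintro _ ⟨j, hj, rfl⟩
    have hj' : j ∈ J := hj
    simp [hj', hl, mul_pow, ← C_pow, hw j]
  exact hle hg

theorem mem_span_of_mul_mem_span_pow_sub_pow {n d : ℕ} (hd : 0 < d) (l : Fin n)
    (J : Finset (Fin n)) (hl : l ∉ J) (f g : MvPolynomial (Fin n) ℂ)
    (hf : ∀ w : Fin n → ℂ, (∀ i, w i ^ d = 1) →
      aeval (fun i => if i ∈ J then C (w i) * X l else X i : Fin n → MvPolynomial (Fin n) ℂ) f
        ≠ 0)
    (hgf : g * f ∈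
      Ideal.span ((fun j : Fin n => (X j ^ d - X l ^ d : MvPolynomial (Fin n) ℂ)) '' J)) :
    g ∈ Ideal.span ((fun j : Fin n => (X j ^ d - X l ^ d : MvPolynomial (Fin n) ℂ)) '' J) := by
  refine mem_span_pow_sub_pow hd l J g fun w hw => ?_
  have h := aeval_eq_zero_of_mem_span_pow_sub_pow l J hl _ hgf w hw
  rw [map_mul] at h
  exact (mul_eq_zero.1 h).resolve_right (hf w hw)

theorem setOf_mem_take_powDiffSeq {n d : ℕ} (hn : n - 1 < n) (k : ℕ) (hk : k ≤ n - 1)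
    (f : MvPolynomial (Fin n) ℂ) :
    {p | p ∈ (powDiffSeq n d ++ [f]).take k} =
      (fun j : Fin n => (X j ^ d - X ⟨n - 1, hn⟩ ^ d : MvPolynomial (Fin n) ℂ)) ''
        (Finset.univ.filter fun j : Fin n => j.1 < k) := by
  have hlen : (powDiffSeq n d).length = n - 1 := by simp [powDiffSeq]
  rw [List.take_append_of_le_length (by omega)]
  ext p
  simp only [Set.mem_ofPred_eq, powDiffSeq, ← List.map_take, List.mem_map, Set.mem_image,
    Finset.coe_filter, Finset.mem_univ, true_and, List.mem_take_iff_getElem, List.getElem_finRange,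
    List.length_finRange]
  constructor
  · rintro ⟨_, ⟨i, hi, rfl⟩, rfl⟩
    exact ⟨⟨i, by omega⟩, by simp; omega, rfl⟩
  · rintro ⟨j, hj, rfl⟩
    exact ⟨⟨j.1, by omega⟩, ⟨j.1, by omega, rfl⟩, rfl⟩

theorem regSeq_powDiffSeq_append {n d : ℕ} (hn : 0 < n) (hd : 0 < d) (f : MvPolynomial (Fin n) ℂ)
    (hf : ∀ w : Fin n → ℂ, (∀ i, w i ^ d = 1) → eval w f ≠ 0) :
    RegSeq (powDiffSeq n d ++ [f]) := by
  classical
  intro i g hg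
  have hlen : (powDiffSeq n d).length = n - 1 := by simp [powDiffSeq]
  obtain ⟨i, hi⟩ := i
  have hi' : i < n := by simp [hlen] at hi; omega
  set l : Fin n := ⟨n - 1, by omega⟩ with hl
  simp only [setOf_mem_take_powDiffSeq (Nat.sub_lt hn one_pos) i (by omega)] at hg ⊢
  refine mem_span_of_mul_mem_span_pow_sub_pow hd l _ (by simp [hl]; omega) _ g
    (fun w hw h0 => ?_) hg
  rcases Nat.lt_or_ge i (n - 1) with h | h
  · have hget : (powDiffSeq n d ++ [f]).get ⟨i, hi⟩ = X ⟨i, hi'⟩ ^ d - X l ^ d := by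
      simp only [List.get_eq_getElem]
      rw [List.getElem_append_left (by omega)]
      simp [powDiffSeq, hl]
    rw [hget] at h0
    have h1 := congrArg (eval fun j : Fin n => if j = l then (0 : ℂ) else 1) h0
    have hnl : ¬ n - 1 < i := by omega
    simp [hl, hnl, hd.ne'] at h1
    omega
  · obtain rfl : i = n - 1 := by omega
    have hget : (powDiffSeq n d ++ [f]).get ⟨n - 1, hi⟩ = f := by
      simp only [List.get_eq_getElem]
      rw [List.getElem_append_right (by omega)]
      simp
    rw [hget] at h0
    have h1 := congrArg (eval fun _ : Fin n => (1 : ℂ)) h0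
    rw [aeval_def, algebraMap_eq, ← coe_eval₂Hom, ← RingHom.comp_apply, map_zero] at h1
    refine hf (fun j => if j.1 < n - 1 then w j else 1)
      (fun j => by split_ifs <;> simp [hw]) (Eq.trans ?_ h1)
    refine RingHom.congr_fun (ringHom_ext (fun r => by simp) fun j => ?_) f
    by_cases hj : j.1 < n - 1 <;> simp [hj]

theorem eval_psum_ne_zero {n d q : ℕ} (hd : 0 < d) (hq : q ∣ d) (hn : n ∉ Gamma (d / q))
    (w : Fin n → ℂ) (hw : ∀ i, w i ^ d = 1) : eval w (psum (Fin n) ℂ q) ≠ 0 := by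
  intro h
  refine hn ?_
  have hcard := card_mem_Gamma_of_sum_eq_zero
    (Nat.div_pos (Nat.le_of_dvd hd hq) (Nat.pos_of_dvd_of_pos hq hd))
    (Finset.univ.val.map fun i : Fin n => w i ^ q)
    (fun z hz => by
      obtain ⟨i, _, rfl⟩ := Multiset.mem_map.1 hz
      rw [← pow_mul, Nat.mul_div_cancel' hq, hw])
    ((by simpa [psum] using h : ∑ i, w i ^ q = 0))
  simpa using hcard

theorem exists_isSymmetric_eval_ne_zero {n d a : ℕ} (hd : 0 < d)
    (ha : a ∈ AddSubmonoid.closure {q : ℕ | q ∣ d ∧ n ∉ Gamma (d / q)}) :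
    ∃ f : MvPolynomial (Fin n) ℂ, f.IsHomogeneous a ∧ f.IsSymmetric ∧
      ∀ w : Fin n → ℂ, (∀ i, w i ^ d = 1) → eval w f ≠ 0 := by
  induction ha using AddSubmonoid.closure_induction with
  | mem q hq =>
    refine ⟨psum (Fin n) ℂ q, IsHomogeneous.sum _ _ _ fun i _ => ?_, psum_isSymmetric _ _ _,
      eval_psum_ne_zero hd hq.1 hq.2⟩
    simpa using (isHomogeneous_X ℂ i).pow q
  | zero => exact ⟨1, isHomogeneous_one _ _, IsSymmetric.one, by simp⟩
  | add x y _ _ hx hy =>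
    obtain ⟨f, hf, hfs, hf0⟩ := hx
    obtain ⟨g, hg, hgs, hg0⟩ := hy
    exact ⟨f * g, hf.mul hg, hfs.mul hgs, fun w hw => by
      rw [map_mul]
      exact mul_ne_zero (hf0 w hw) (hg0 w hw)⟩

theorem S_semigroup (n d a : ℕ) (hn : 2 ≤ n) (hd : 0 < d) (ha : 0 < a)
    (haS : a ∈ AddSubmonoid.closure {q : ℕ | q ∣ d ∧ n ∉ Gamma (d / q)}) :
    GoodTriple n d a := by
  obtain ⟨f, hf, hfs, hf0⟩ := exists_isSymmetric_eval_ne_zero hd haS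
  exact ⟨f, hf, hfs, regSeq_powDiffSeq_append (by omega) hd f hf0⟩
end

section
/- Let n ≥ 2 and let d, a be positive integers. If n ∈ Γ(d) and a ∉ Γ(d), then the triple (n,d,a) is bad. -/
open MvPolynomial

theorem MvPolynomial.IsHomogeneous.aeval_smul_const {σ R A : Type*} [CommSemiring R]
    [CommSemiring A] [Algebra R A] {f : MvPolynomial σ R} {a : ℕ} (hf : f.IsHomogeneous a)
    (z : σ → R) (x : A) :
    MvPolynomial.aeval (fun i => z i • x) f = MvPolynomial.eval z f • x ^ a := by
  rw [MvPolynomial.aeval_def, MvPolynomial.eval₂_eq, MvPolynomial.eval_eq, Finset.sum_smul]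
  refine Finset.sum_congr rfl fun m hm => ?_
  have hdeg : ∑ i ∈ m.support, m i = a := by
    have h := hf (mem_support_iff.mp hm)
    simpa [Finsupp.weight_apply, Finsupp.sum] using h
  simp only [smul_pow, Finset.prod_smul, Finset.prod_pow_eq_pow_sum, hdeg]
  rw [← Algebra.smul_def, smul_smul]

theorem MvPolynomial.isHomogeneous_esymm (σ R : Type*) [Fintype σ] [CommSemiring R] (k : ℕ) :
    (esymm σ R k).IsHomogeneous k := by
  refine IsHomogeneous.sum _ _ _ fun s hs => ?_
  simpa [(Finset.mem_powersetCard.mp hs).2] using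
    IsHomogeneous.prod s (fun i => (X i : MvPolynomial σ R)) (fun _ => 1)
      fun i _ => isHomogeneous_X R i

/-- The polynomials all of whose exponents lie in a given additive submonoid of `ℕ`. -/
def Polynomial.exponentSubalgebra (R : Type*) [CommSemiring R] (S : AddSubmonoid ℕ) :
    Subalgebra R (Polynomial R) where
  carrier := {p | ∀ k, p.coeff k ≠ 0 → k ∈ S}
  mul_mem' {p q} hp hq k hk := by
    rw [Polynomial.coeff_mul] at hk
    obtain ⟨⟨i, j⟩, hij, h⟩ := Finset.exists_ne_zero_of_sum_ne_zero hk
    rw [← Finset.HasAntidiagonal.mem_antidiagonal.mp hij]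
    exact S.add_mem (hp i (left_ne_zero_of_mul h)) (hq j (right_ne_zero_of_mul h))
  add_mem' {p q} hp hq k hk := by
    by_contra hS
    exact hk (by rw [Polynomial.coeff_add, not_not.mp (mt (hp k) hS),
      not_not.mp (mt (hq k) hS), add_zero])
  algebraMap_mem' r k hk := by
    rw [Polynomial.algebraMap_apply, Polynomial.coeff_C] at hk
    obtain rfl : k = 0 := by
      by_contra h
      simp [h] at hk
    exact S.zero_mem

/-- If the elementary symmetric polynomials of degree outside `S` vanish at `z`, so does every
homogeneous symmetric polynomial of degree outside `S`. -/
theorem MvPolynomial.IsSymmetric.eval_eq_zero_of_esymm {σ R : Type*} [Fintype σ] [CommRing R]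
    {f : MvPolynomial σ R} {a : ℕ} (hs : f.IsSymmetric) (hf : f.IsHomogeneous a)
    {S : AddSubmonoid ℕ} (ha : a ∉ S) {z : σ → R}
    (hz : ∀ k, eval z (esymm σ R k) ≠ 0 → k ∈ S) :
    eval z f = 0 := by
  obtain ⟨Φ, hΦ⟩ := esymmAlgHom_surjective (σ := σ) (R := R) (n := Fintype.card σ) le_rfl ⟨f, hs⟩
  replace hΦ : aeval (fun i : Fin (Fintype.card σ) => esymm σ R (i + 1)) Φ = f := by
    rw [← esymmAlgHom_apply, hΦ]
  have hmem : aeval (fun i => z i • (Polynomial.X : Polynomial R)) f ∈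
      Polynomial.exponentSubalgebra R S := by
    rw [← hΦ]
    clear hΦ
    induction Φ using MvPolynomial.induction_on with
    | C r =>
      rw [algHom_C, AlgHom.commutes]
      exact Subalgebra.algebraMap_mem _ r
    | add p q hp hq =>
      rw [map_add, map_add]
      exact add_mem hp hq
    | mul_X p i hp =>
      rw [map_mul, map_mul, aeval_X, (isHomogeneous_esymm σ R (i + 1)).aeval_smul_const]
      refine mul_mem hp fun k hk => ?_
      rw [Polynomial.coeff_smul, Polynomial.coeff_X_pow] at hk
      split_ifs at hk with h
      · exact h ▸ hz _ (by simpa using hk)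
      · simp at hk
  rw [hf.aeval_smul_const] at hmem
  by_contra h
  exact ha (hmem a (by simpa using h))

theorem exists_rootsOfUnity_multiset {d n : ℕ} (hn : n ∈ Gamma d) :
    ∃ s : Multiset ℂ, s.card = n ∧ (∀ r ∈ s, r ^ d = 1) ∧
      ∀ k, (s.map fun r => Polynomial.X - Polynomial.C r).prod.coeff k ≠ 0 →
        ∃ g ∈ Gamma d, k + g = n := by
  induction hn using AddSubmonoid.closure_induction with
  | zero =>
    refine ⟨0, rfl, by simp, fun k hk => ⟨0, (Gamma d).zero_mem, ?_⟩⟩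
    by_contra h
    rw [add_zero] at h
    simp [Polynomial.coeff_one, h] at hk
  | mem p hp =>
    obtain ⟨hp, m, rfl⟩ := hp
    have hζ := Complex.isPrimitiveRoot_exp p hp.ne_zero
    refine ⟨(Polynomial.nthRootsFinset p (1 : ℂ)).val, hζ.card_nthRootsFinset, ?_, ?_⟩
    · intro r hr
      rw [pow_mul, (Polynomial.mem_nthRootsFinset hp.pos 1).mp hr, one_pow]
    · intro k hk
      change (∏ r ∈ Polynomial.nthRootsFinset p (1 : ℂ),
        (Polynomial.X - Polynomial.C r)).coeff k ≠ 0 at hk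
      rw [← Polynomial.X_pow_sub_one_eq_prod hp.pos hζ, Polynomial.coeff_sub,
        Polynomial.coeff_X_pow, Polynomial.coeff_one] at hk
      by_cases hkp : k = p
      · exact ⟨0, (Gamma _).zero_mem, by simp [hkp]⟩
      · have hk0 : k = 0 := by
          by_contra h
          simp [hkp, h] at hk
        exact ⟨p, AddSubmonoid.subset_closure ⟨hp, dvd_mul_right _ _⟩, by simp [hk0]⟩
  | add m n _ _ hm hn =>
    obtain ⟨s, hs, hsd, hsc⟩ := hm
    obtain ⟨t, ht, htd, htc⟩ := hn
    refine ⟨s + t, by simp [hs, ht], fun r hr => ?_, fun k hk => ?_⟩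
    · exact (Multiset.mem_add.mp hr).elim (hsd r) (htd r)
    · rw [Multiset.map_add, Multiset.prod_add, Polynomial.coeff_mul] at hk
      obtain ⟨⟨i, j⟩, hij, h⟩ := Finset.exists_ne_zero_of_sum_ne_zero hk
      obtain ⟨g, hg, hig⟩ := hsc i (left_ne_zero_of_mul h)
      obtain ⟨g', hg', hjg⟩ := htc j (right_ne_zero_of_mul h)
      refine ⟨g + g', (Gamma d).add_mem hg hg', ?_⟩
      have := Finset.HasAntidiagonal.mem_antidiagonal.mp hij
      simp only at this
      omega

theorem exists_rootsOfUnity_esymm {d n : ℕ} (hn : n ∈ Gamma d) :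
    ∃ z : Fin n → ℂ, (∀ i, z i ^ d = 1) ∧
      ∀ k, eval z (esymm (Fin n) ℂ k) ≠ 0 → k ∈ Gamma d := by
  obtain ⟨s, hs, hsd, hsc⟩ := exists_rootsOfUnity_multiset hn
  obtain ⟨l, rfl⟩ := Quot.exists_rep s
  obtain rfl : l.length = n := hs
  have hl : (Finset.univ : Finset (Fin l.length)).val.map l.get = (l : Multiset ℂ) := by
    simp [Fin.univ_val_map]
  refine ⟨l.get, fun i => hsd _ (List.get_mem l i), fun k hk => ?_⟩
  have hk' : (l : Multiset ℂ).esymm k ≠ 0 := by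
    rw [← hl, ← aeval_esymm_eq_multiset_esymm (Fin l.length) ℂ]
    simpa [aeval_eq_eval] using hk
  have hkn : k ≤ l.length := by
    by_contra! h
    exact hk' (by simp [Multiset.esymm, Multiset.powersetCard_eq_empty k (s := (l : Multiset ℂ)) h])
  obtain ⟨g, hg, hkg⟩ := hsc (l.length - k) (by
    have := Multiset.prod_X_sub_C_coeff (l : Multiset ℂ) (k := l.length - k) (by simp)
    rw [Multiset.coe_card, Nat.sub_sub_self hkn] at this
    refine this.trans_ne ?_
    simpa using hk')
  obtain rfl : g = k := by omega
  exact hg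

theorem X_pow_sub_X_pow_mem_span_powDiffSeq (n d : ℕ) (hn : 0 < n) (i : Fin n) :
    (X i ^ d - X ⟨n - 1, by omega⟩ ^ d : MvPolynomial (Fin n) ℂ) ∈
      Ideal.span {p | p ∈ powDiffSeq n d} := by
  by_cases hi : i.1 = n - 1
  · simp [show i = ⟨n - 1, by omega⟩ from Fin.ext hi]
  · refine Ideal.subset_span ?_
    have hi' := i.isLt
    exact List.mem_map.mpr ⟨⟨i.1, by omega⟩, List.mem_finRange _, rfl⟩

theorem eval_eq_zero_of_mem_span_powDiffSeq {n d : ℕ} {z : Fin n → ℂ} (hz : ∀ i, z i ^ d = 1)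
    {g : MvPolynomial (Fin n) ℂ} (hg : g ∈ Ideal.span {p | p ∈ powDiffSeq n d}) :
    eval z g = 0 := by
  have h : Ideal.span {p | p ∈ powDiffSeq n d} ≤ RingHom.ker (eval z) := by
    rw [Ideal.span_le]
    intro p hp
    obtain ⟨i, -, rfl⟩ := List.mem_map.mp hp
    simp [RingHom.mem_ker, hz]
  exact h hg

/-- The sequence `powDiffSeq n d ++ [f]` is not regular if `f` is homogeneous and vanishes at a
point whose coordinates are all `d`-th roots of unity. -/
theorem not_regSeq_of_eval_eq_zero {n d a : ℕ} (hn : 0 < n) (hd : 0 < d) {z : Fin n → ℂ}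
    (hz : ∀ i, z i ^ d = 1) {f : MvPolynomial (Fin n) ℂ} (hf : f.IsHomogeneous a)
    (hfz : eval z f = 0) : ¬ RegSeq (powDiffSeq n d ++ [f]) := by
  intro hreg
  have hlast := hreg ⟨(powDiffSeq n d).length, by simp⟩
  simp only [List.get_eq_getElem, List.getElem_concat_length, List.take_left'] at hlast
  set I : Ideal (MvPolynomial (Fin n) ℂ) := Ideal.span {p | p ∈ powDiffSeq n d}
  set y : MvPolynomial (Fin n) ℂ := X ⟨n - 1, by omega⟩ with hy
  set c : ℂ := z ⟨n - 1, by omega⟩ with hc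
  have hz0 : ∀ i, z i ≠ 0 := fun i h => by simpa [h, hd.ne'] using hz i
  let w : Fin n → MvPolynomial (Fin n) ℂ := fun i => z i • c⁻¹ • y
  have hwd : ∀ i, w i ^ d = y ^ d := fun i => by simp [w, smul_pow, hz, hc]
  let g : Fin n → MvPolynomial (Fin n) ℂ := fun i =>
    ∑ k ∈ Finset.range d, X i ^ k * w i ^ (d - 1 - k)
  have hgI : ∀ i, g i * (X i - w i) ∈ I := fun i => by
    rw [(Commute.all _ _).geom_sum₂_mul, hwd]
    exact X_pow_sub_X_pow_mem_span_powDiffSeq n d hn i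
  have hgz : ∀ i, eval z (g i) ≠ 0 := fun i => by
    have hw : eval z (w i) = z i := by
      simp [w, hy, smul_eval, ← hc, inv_mul_cancel₀ (show c ≠ 0 from hz0 _)]
    have : eval z (g i) = d * z i ^ (d - 1) := by
      simp only [g, map_sum, map_mul, map_pow, eval_X, hw]
      rw [Finset.sum_congr rfl fun k hk => by
        rw [← pow_add, Nat.add_sub_cancel' (by have := Finset.mem_range.mp hk; omega)]]
      simp
    rw [this]
    exact mul_ne_zero (by exact_mod_cast hd.ne') (pow_ne_zero _ (hz0 i))
  let G := ∏ i, g i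
  let J : Ideal (MvPolynomial (Fin n) ℂ) := Submodule.comap (LinearMap.mulLeft _ G) I
  have hJ : ∀ i, X i - w i ∈ J := fun i => by
    change G * (X i - w i) ∈ I
    obtain ⟨b, hb⟩ := Finset.dvd_prod_of_mem g (Finset.mem_univ i)
    rw [show G = b * g i by rw [mul_comm]; exact hb, mul_assoc]
    exact I.mul_mem_left _ (hgI i)
  have hhom : Ideal.Quotient.mkₐ ℂ J = (Ideal.Quotient.mkₐ ℂ J).comp (aeval w) := by
    refine algHom_ext fun i => ?_
    simpa using Ideal.Quotient.eq.mpr (hJ i)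
  have hfJ : f ∈ J := by
    have h : Ideal.Quotient.mkₐ ℂ J f = Ideal.Quotient.mkₐ ℂ J (aeval w f) :=
      DFunLike.congr_fun hhom f
    rw [hf.aeval_smul_const, hfz, zero_smul, map_zero] at h
    exact Ideal.Quotient.eq_zero_iff_mem.mp h
  have hG : eval z G = 0 := eval_eq_zero_of_mem_span_powDiffSeq hz (hlast G hfJ)
  rw [map_prod] at hG
  exact Finset.prod_ne_zero_iff.mpr (fun i _ => hgz i) hG

theorem coprime_lemma (n d a : ℕ) (hn : 2 ≤ n) (hd : 0 < d) (ha : 0 < a)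
    (hnG : n ∈ Gamma d) (haG : a ∉ Gamma d) :
    ¬ GoodTriple n d a := by
  rintro ⟨f, hf, hs, hreg⟩
  obtain ⟨z, hz, hze⟩ := exists_rootsOfUnity_esymm hnG
  exact not_regSeq_of_eval_eq_zero (by omega) hd hz hf (hs.eval_eq_zero_of_esymm hf haG hze) hreg
end

section
/- Let n ≥ 2 and let d, a be positive integers, and set g = gcd(d,n). If g does not divide a, then the triple (n,d,a) is bad. -/
open MvPolynomial

/-- A homogeneous polynomial of degree `a` scales by `c ^ a` when its arguments scale by `c`. -/
theorem aeval_mul_left_of_isHomogeneous {σ R A : Type*} [CommSemiring R]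
    [CommSemiring A] [Algebra R A] {f : MvPolynomial σ R} {a : ℕ} (hf : f.IsHomogeneous a)
    (c : A) (v : σ → A) :
    aeval (fun i => c * v i) f = c ^ a * aeval v f := by
  rw [aeval_def, aeval_def, eval₂_eq, eval₂_eq, Finset.mul_sum]
  refine Finset.sum_congr rfl fun m hm => ?_
  have hdeg : ∑ i ∈ m.support, m i = a := by
    rw [← Finsupp.degree_apply, Finsupp.degree_eq_weight_one]
    exact hf (mem_support_iff.mp hm)
  simp only [mul_pow, Finset.prod_mul_distrib, Finset.prod_pow_eq_pow_sum, hdeg]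
  ring

/-- A symmetric homogeneous polynomial vanishes at a point whose coordinates are permuted by
scaling with `c`, unless `c ^ a = 1`. -/
theorem aeval_eq_zero_of_scaling {σ K : Type*} [Field K]
    {f : MvPolynomial σ K} {a : ℕ} (hsym : f.IsSymmetric) (hf : f.IsHomogeneous a)
    {c : K} (hc : c ^ a ≠ 1) {p : σ → K} (e : Equiv.Perm σ) (hp : ∀ i, p (e i) = c * p i) :
    aeval p f = 0 := by
  have h : aeval p f = c ^ a * aeval p f := by
    rw [← aeval_mul_left_of_isHomogeneous hf c p]
    conv_lhs => rw [← hsym e, aeval_rename]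
    congr 2
    exact funext hp
  have h' : (c ^ a - 1) * aeval p f = 0 := by linear_combination -h
  exact (mul_eq_zero.mp h').resolve_left (sub_ne_zero.mpr hc)

/-- If `p` is a point of `d`-th roots of unity, normalized by `p k = 1`, and `f` is homogeneous
with `f p = 0`, then `f` is a zero divisor modulo any ideal that vanishes at `p` and contains all
`X i ^ d - X k ^ d`. -/
theorem exists_mul_mem_notMem_of_aeval_eq_zero {σ K : Type*} [Fintype σ] [Field K] [CharZero K]
    {d a : ℕ} (hd : 0 < d) {I : Ideal (MvPolynomial σ K)} {k : σ}
    (hI : ∀ i, X i ^ d - X k ^ d ∈ I) {p : σ → K} (hpd : ∀ i, p i ^ d = 1) (hpk : p k = 1)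
    (hIp : ∀ u ∈ I, aeval p u = 0) {f : MvPolynomial σ K} (hf : f.IsHomogeneous a)
    (hfp : aeval p f = 0) :
    ∃ h, h * f ∈ I ∧ h ∉ I := by
  let q : σ → MvPolynomial σ K := fun i =>
    ∑ j ∈ Finset.range d, X i ^ j * (C (p i) * X k) ^ (d - 1 - j)
  have hq : ∀ i, q i * (X i - C (p i) * X k) ∈ I := by
    intro i
    have : q i * (X i - C (p i) * X k) = X i ^ d - X k ^ d := by
      rw [(Commute.all _ _).geom_sum₂_mul, mul_pow, ← C_pow, hpd, C_1, one_mul]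
    exact this ▸ hI i
  have hqp : ∀ i, aeval p (q i) ≠ 0 := by
    intro i
    have hval : aeval p (q i) = d * p i ^ (d - 1) := by
      simp only [q, map_sum, map_mul, map_pow, aeval_X, aeval_C, hpk, mul_one,
        Algebra.algebraMap_self, RingHom.id_apply]
      rw [Finset.sum_congr rfl (g := fun _ => p i ^ (d - 1))]
      · simp
      · intro j hj
        rw [← pow_add]
        congr 1
        have := Finset.mem_range.mp hj
        omega
    rw [hval]
    refine mul_ne_zero (Nat.cast_ne_zero.mpr hd.ne') (pow_ne_zero _ fun h0 => ?_)
    simpa [h0, hd.ne'] using hpd i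
  refine ⟨∏ i, q i, ?_, fun hmem => ?_⟩
  · let J : Ideal (MvPolynomial σ K) :=
      Submodule.comap (LinearMap.mulLeft (MvPolynomial σ K) (∏ i, q i)) I
    have hJ : ∀ u, u ∈ J ↔ (∏ i, q i) * u ∈ I := fun u => Iff.rfl
    rw [← hJ, ← Ideal.Quotient.eq_zero_iff_mem]
    have hX : ∀ i, Ideal.Quotient.mkₐ K J (X i) =
        Ideal.Quotient.mkₐ K J (X k) * algebraMap K _ (p i) := by
      intro i
      rw [mul_comm, ← (Ideal.Quotient.mkₐ K J).commutes, ← map_mul]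
      refine Ideal.Quotient.eq.mpr ((hJ _).mpr ?_)
      obtain ⟨r, hr⟩ := Finset.dvd_prod_of_mem q (Finset.mem_univ i)
      rw [hr, mul_right_comm]
      exact I.mul_mem_right r (hq i)
    change Ideal.Quotient.mkₐ K J f = 0
    have hcomp := comp_aeval_apply X (Ideal.Quotient.mkₐ K J) f
    rw [aeval_X_left_apply] at hcomp
    have hconst : aeval (fun i => algebraMap K (MvPolynomial σ K ⧸ J) (p i)) f = 0 :=
      (aeval_algebraMap_apply _ p f).trans (by rw [hfp, map_zero])
    rw [hcomp, funext hX, aeval_mul_left_of_isHomogeneous hf, hconst, mul_zero]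
  · have := hIp _ hmem
    rw [map_prod] at this
    exact Finset.prod_ne_zero_iff.mpr (fun i _ => hqp i) this

theorem gcd_not_dvd_bad (n d a : ℕ) (hn : 2 ≤ n) (hd : 0 < d) (ha : 0 < a)
    (hga : ¬ Nat.gcd d n ∣ a) :
    ¬ GoodTriple n d a := by
  rintro ⟨f, hf, hsym, hreg⟩
  obtain ⟨m, rfl⟩ : ∃ m, n = m + 1 := ⟨n - 1, by omega⟩
  have hg : Nat.gcd d (m + 1) ≠ 0 := Nat.gcd_ne_zero_right (by omega)
  obtain ⟨ζ, hζ⟩ : ∃ ζ : ℂ, IsPrimitiveRoot ζ (Nat.gcd d (m + 1)) :=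
    ⟨_, Complex.isPrimitiveRoot_exp _ hg⟩
  have hζd : ζ ^ d = 1 := (hζ.pow_eq_one_iff_dvd d).mpr (Nat.gcd_dvd_left _ _)
  have hζn : ζ ^ (m + 1) = 1 := (hζ.pow_eq_one_iff_dvd _).mpr (Nat.gcd_dvd_right _ _)
  have hζa : ζ ^ a ≠ 1 := fun h => hga ((hζ.pow_eq_one_iff_dvd a).mp h)
  let p : Fin (m + 1) → ℂ := fun i => ζ ^ (i.1 + 1)
  have hpd : ∀ i, p i ^ d = 1 := fun i => by
    rw [← pow_mul, mul_comm, pow_mul, hζd, one_pow]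
  have hpk : p (Fin.last m) = 1 := hζn
  have hfp : aeval p f = 0 := by
    refine aeval_eq_zero_of_scaling hsym hf hζa (finRotate (m + 1)) fun i => ?_
    induction i using Fin.lastCases with
    | last => simp [p, hζn]
    | cast i =>
      rw [finRotate_apply, Fin.coeSucc_eq_succ]
      simp only [p, Fin.val_succ, Fin.val_castSucc]
      ring
  have hlast := hreg ⟨(powDiffSeq (m + 1) d).length, by simp⟩
  simp only [List.get_eq_getElem, List.getElem_append_right, le_refl, Nat.sub_self,
    List.getElem_cons_zero, List.take_left] at hlast
  obtain ⟨h, hhf, hh⟩ := exists_mul_mem_notMem_of_aeval_eq_zero hd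
    (I := Ideal.span {u | u ∈ powDiffSeq (m + 1) d}) (k := Fin.last m) (fun i => by
      induction i using Fin.lastCases with
      | last => simp
      | cast i =>
        refine Ideal.subset_span (List.mem_map.mpr ⟨i, List.mem_finRange i, rfl⟩)) hpd hpk
    (fun u hu => by
      rw [← RingHom.mem_ker]
      revert u
      change Ideal.span _ ≤ RingHom.ker (aeval p)
      rw [Ideal.span_le]
      intro u hu
      obtain ⟨i, -, rfl⟩ := List.mem_map.mp hu
      simp [RingHom.mem_ker, hpd]) hf hfp
  exact hh (hlast h hhf)
end

section
/- Let d, v be positive integers and let Q = (z_1,…,z_n) ∈ 𝒱_d ⊂ ℂ^n. Then Q is v-symmetric if and only if v divides n and e_j(Q) = 0 for every j ∈ {1,…,n} such that v does not divide j, where e_j denotes the j-th elementary symmetric polynomial in n variables. -/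
open MvPolynomial

/-- `𝒱_d`: the set of points `(z_1,…,z_n)` with `z_i^d = 1` for all `i` and `z_n = 1`. -/
def Vset (n d : ℕ) : Set (Fin n → ℂ) :=
  {z | (∀ i, z i ^ d = 1) ∧ ∀ i : Fin n, (i : ℕ) = n - 1 → z i = 1}

/-- A point `Q = (z_1,…,z_n)` is `v`-symmetric if multiplication by a primitive
`v`-th root of unity permutes its coordinates. -/
def IsSymPoint {n : ℕ} (v : ℕ) (z : Fin n → ℂ) : Prop :=
  ∀ ε : ℂ, IsPrimitiveRoot ε v →
    ∃ τ : Equiv.Perm (Fin n), ∀ i, ε * z i = z (τ i)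

lemma exists_perm_of_map_univ_eq {ι α : Type*} [Fintype ι] {f g : ι → α}
    (h : Finset.univ.val.map f = Finset.univ.val.map g) :
    ∃ τ : Equiv.Perm ι, ∀ i, f i = g (τ i) := by
  classical
  have hcard (c : α) : Nonempty ({i // f i = c} ≃ {i // g i = c}) := by
    refine Fintype.card_eq.mp ?_
    have hc := congrArg (Multiset.count c) h
    simp only [Multiset.count_map, eq_comm (a := c)] at hc
    rw [Fintype.card_subtype, Fintype.card_subtype]
    exact hc
  exact ⟨Equiv.ofFiberEquiv fun c => (hcard c).some,
    fun i => (Equiv.ofFiberEquiv_map (fun c => (hcard c).some) i).symm⟩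

lemma Multiset.eq_of_forall_esymm_eq {R : Type*} [CommRing R] [IsDomain R] {s t : Multiset R}
    (hcard : s.card = t.card) (h : ∀ j ≤ s.card, s.esymm j = t.esymm j) : s = t := by
  have hprod : (s.map fun a => Polynomial.X - Polynomial.C a).prod =
      (t.map fun a => Polynomial.X - Polynomial.C a).prod := by
    rw [Multiset.prod_X_sub_X_eq_sum_esymm, Multiset.prod_X_sub_X_eq_sum_esymm, ← hcard]
    refine Finset.sum_congr rfl fun j hj => ?_
    rw [h j (Nat.lt_succ_iff.mp (Finset.mem_range.mp hj))]
  rw [← Polynomial.roots_multiset_prod_X_sub_C s, hprod, Polynomial.roots_multiset_prod_X_sub_C]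

lemma eval_esymm_eq_multiset_esymm {σ R : Type*} [Fintype σ] [CommRing R] (z : σ → R) (j : ℕ) :
    eval z (esymm σ R j) = (Finset.univ.val.map z).esymm j := by
  rw [← aeval_esymm_eq_multiset_esymm σ R, aeval_eq_eval]

lemma eval_mul_esymm {σ R : Type*} [Fintype σ] [CommRing R] (c : R) (z : σ → R) (j : ℕ) :
    eval (fun i => c * z i) (esymm σ R j) = c ^ j * eval z (esymm σ R j) := by
  simp only [esymm, map_sum, map_prod, eval_X, Finset.mul_sum]
  refine Finset.sum_congr rfl fun s hs => ?_
  rw [Finset.prod_mul_distrib, Finset.prod_const, (Finset.mem_powersetCard.mp hs).2]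

lemma eval_comp_perm_esymm {σ R : Type*} [Fintype σ] [CommRing R] (z : σ → R)
    (τ : Equiv.Perm σ) (j : ℕ) :
    eval (fun i => z (τ i)) (esymm σ R j) = eval z (esymm σ R j) := by
  conv_rhs => rw [← esymm_isSymmetric σ R j τ, eval_rename]
  rfl

lemma eval_esymm_card {σ R : Type*} [Fintype σ] [CommRing R] (z : σ → R) :
    eval z (esymm σ R (Fintype.card σ)) = ∏ i, z i := by
  simp [esymm, ← Finset.card_univ, Finset.powersetCard_self]

theorem is_symmetric_iff (n d v : ℕ) (hd : 0 < d) (hv : 0 < v)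
    (z : Fin n → ℂ) (hz : z ∈ Vset n d) :
    IsSymPoint v z ↔
      (v ∣ n ∧ ∀ j, 1 ≤ j → j ≤ n → ¬ v ∣ j →
        eval z (esymm (Fin n) ℂ j) = 0) := by
  constructor
  · intro h
    have hε := Complex.isPrimitiveRoot_exp v hv.ne'
    obtain ⟨τ, hτ⟩ := h _ hε
    have key (j : ℕ) (hj : ¬ v ∣ j) : eval z (esymm (Fin n) ℂ j) = 0 := by
      have hmul := eval_mul_esymm (Complex.exp (2 * Real.pi * Complex.I / v)) z j
      rw [funext hτ, eval_comp_perm_esymm] at hmul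
      by_contra h0
      exact hj ((hε.pow_eq_one_iff_dvd j).mp (mul_eq_right₀ h0 |>.mp hmul.symm))
    refine ⟨?_, fun j _ _ => key j⟩
    by_contra hn
    have h0 := eval_esymm_card z
    rw [Fintype.card_fin, key n hn] at h0
    obtain ⟨i, -, hi⟩ := Finset.prod_eq_zero_iff.mp h0.symm
    have hi' := hz.1 i
    rw [hi, zero_pow hd.ne'] at hi'
    exact zero_ne_one hi'
  · rintro ⟨-, h⟩ ε hε
    refine exists_perm_of_map_univ_eq (Multiset.eq_of_forall_esymm_eq (by simp) fun j hj => ?_)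
    rw [← eval_esymm_eq_multiset_esymm, ← eval_esymm_eq_multiset_esymm, eval_mul_esymm]
    by_cases hvj : v ∣ j
    · rw [(hε.pow_eq_one_iff_dvd j).mpr hvj, one_mul]
    · have hj1 : 1 ≤ j := Nat.one_le_iff_ne_zero.mpr fun h0 => hvj (h0 ▸ dvd_zero v)
      rw [h j hj1 (by simpa using hj) hvj, mul_zero]
end

section
/- Let d, v, m be positive integers and suppose Q = (z_1,…,z_n) ∈ 𝒱_d is v^m-symmetric and the point (z_1^{v^m}, z_2^{v^m}, …, z_n^{v^m}) is v-symmetric. Then Q is v^{m+1}-symmetric. -/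
theorem exists_perm_mul_eq_iff {ι K : Type*} [Fintype ι] [Field K] [DecidableEq K]
    {ε : K} (hε : ε ≠ 0) (z : ι → K) :
    (∃ τ : Equiv.Perm ι, ∀ i, ε * z i = z (τ i)) ↔
      ∀ w, Fintype.card {i // z i = ε * w} = Fintype.card {i // z i = w} := by
  constructor
  · rintro ⟨τ, hτ⟩ w
    refine (Fintype.card_congr (τ.subtypeEquiv fun i => ?_)).symm
    rw [← hτ, mul_right_inj' hε]
  · intro h
    have key : ∀ c, Nonempty ({i // ε * z i = c} ≃ {i // z i = c}) := fun c => by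
      refine ⟨(Equiv.subtypeEquivRight fun i => ?_).trans
        (Fintype.equivOfCardEq (h (ε⁻¹ * c)).symm |>.trans
          (Equiv.subtypeEquivRight fun i => ?_))⟩
      · rw [eq_inv_mul_iff_mul_eq₀ hε]
      · rw [mul_inv_cancel_left₀ hε]
    exact ⟨Equiv.ofFiberEquiv (f := fun i => ε * z i) (g := z) fun c => (key c).some,
      fun i => (Equiv.ofFiberEquiv_map (f := fun i => ε * z i) (g := z) _ i).symm⟩

/-- If multiplication by a primitive `k`-th root of unity preserves the multiplicities of the
values of `z`, then `w ^ k` is a value of `z ^ k` with `k` times the multiplicity of `w` in `z`. -/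
theorem card_pow_eq_pow {ι K : Type*} [Fintype ι] [Field K] [DecidableEq K]
    {ζ : K} {k : ℕ} (hk : 0 < k) (hζ : IsPrimitiveRoot ζ k) {z : ι → K}
    (h : ∀ w, Fintype.card {i // z i = ζ * w} = Fintype.card {i // z i = w})
    {w : K} (hw : w ≠ 0) :
    Fintype.card {i // z i ^ k = w ^ k} = k * Fintype.card {i // z i = w} := by
  have hpow : ∀ j : ℕ, Fintype.card {i // z i = ζ ^ j * w} = Fintype.card {i // z i = w} := by
    intro j
    induction j with
    | zero => simp
    | succ j ih => simp only [pow_succ', mul_assoc, h, ih]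
  simp only [Fintype.card_subtype] at hpow ⊢
  rw [Finset.card_eq_sum_card_fiberwise (f := fun i => z i / w)
    (t := Polynomial.nthRootsFinset k (1 : K)),
    Finset.sum_congr rfl (g := fun _ => (Finset.univ.filter fun i => z i = w).card),
    Finset.sum_const, hζ.card_nthRootsFinset, smul_eq_mul]
  · intro μ hμ
    have : NeZero k := ⟨hk.ne'⟩
    rw [Polynomial.mem_nthRootsFinset hk] at hμ
    obtain ⟨j, -, rfl⟩ := hζ.eq_pow_of_pow_eq_one hμ
    rw [← hpow j]
    congr 1
    ext i
    simp only [Finset.mem_filter, Finset.mem_univ, true_and, div_eq_iff hw]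
    refine ⟨And.right, fun hi => ⟨?_, hi⟩⟩
    rw [hi, mul_pow, hμ, one_mul]
  · intro i hi
    simp only [Finset.coe_filter, Finset.mem_univ, true_and, Set.mem_ofPred_eq] at hi
    simp only [Finset.mem_coe, Polynomial.mem_nthRootsFinset hk]
    rw [div_pow, hi, div_self (pow_ne_zero _ hw)]

theorem pow_symmetric (n d v m : ℕ) (hd : 0 < d) (hv : 0 < v) (hm : 0 < m)
    (z : Fin n → ℂ) (hz : z ∈ Vset n d)
    (h1 : IsSymPoint (v ^ m) z)
    (h2 : IsSymPoint v fun i => z i ^ v ^ m) :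
    IsSymPoint (v ^ (m + 1)) z := by
  intro η hη
  have hk : 0 < v ^ m := pow_pos hv m
  have hζ : IsPrimitiveRoot (η ^ v) (v ^ m) :=
    hη.pow (pow_pos hv _) (pow_succ' v m)
  have hε : IsPrimitiveRoot (η ^ v ^ m) v :=
    hη.pow (pow_pos hv _) (pow_succ v m)
  have hη0 : η ≠ 0 := hη.ne_zero (pow_pos hv _).ne'
  have c1 := (exists_perm_mul_eq_iff (hζ.ne_zero hk.ne') z).1 (h1 _ hζ)
  have c2 := (exists_perm_mul_eq_iff (hε.ne_zero hv.ne') _).1 (h2 _ hε)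
  rw [exists_perm_mul_eq_iff hη0]
  intro w
  rcases eq_or_ne w 0 with rfl | hw
  · simp only [mul_zero]
  · apply Nat.eq_of_mul_eq_mul_left hk
    rw [← card_pow_eq_pow hk hζ c1 hw, ← card_pow_eq_pow hk hζ c1 (mul_ne_zero hη0 hw),
      ← c2 (w ^ v ^ m)]
    simp only [mul_pow]
end

section
/- Let n ≥ 2, let d, a be positive integers, and let p be a prime. Suppose that every point Q ∈ 𝒱_d ⊆ ℂ^n with 𝒫_1(Q) = z_1 + ⋯ + z_n = 0 is p-symmetric. Set g = gcd(d,n) and assume p divides g. Then the triple (n,d,a) is bad if and only if g does not divide a. -/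
open MvPolynomial

theorem MvPolynomial.IsHomogeneous.aeval_mul_left {σ R A : Type*} [CommSemiring R]
    [CommSemiring A] [Algebra R A] {φ : MvPolynomial σ R} {m : ℕ} (hφ : φ.IsHomogeneous m)
    (c : A) (g : σ → A) :
    MvPolynomial.aeval (fun i => c * g i) φ = c ^ m * MvPolynomial.aeval g φ := by
  rw [aeval_def, aeval_def, eval₂_eq, eval₂_eq, Finset.mul_sum]
  refine Finset.sum_congr rfl fun e he => ?_
  have hdeg : ∑ i ∈ e.support, e i = m := by
    rw [← hφ (mem_support_iff.mp he), Finsupp.weight_apply]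
    simp [Finsupp.sum]
  rw [← hdeg, ← Finset.prod_pow_eq_pow_sum]
  simp only [mul_pow, Finset.prod_mul_distrib]
  ring

/-- Substitute `ω j * X l` for the variables `X j` with `j < k`. -/
noncomputable def rootSubst {n : ℕ} (l : Fin n) (k : ℕ) (ω : Fin n → ℂ) :
    MvPolynomial (Fin n) ℂ →ₐ[ℂ] MvPolynomial (Fin n) ℂ :=
  aeval fun j => if (j : ℕ) < k then C (ω j) * X l else X j

@[simp]
theorem rootSubst_X {n : ℕ} (l : Fin n) (k : ℕ) (ω : Fin n → ℂ) (j : Fin n) :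
    rootSubst l k ω (X j) = if (j : ℕ) < k then C (ω j) * X l else X j :=
  aeval_X _ j

/-- The ideal generated by the `X j ^ d - X l ^ d` with `j < k`. -/
noncomputable def powDiffIdeal {n : ℕ} (l : Fin n) (d k : ℕ) : Ideal (MvPolynomial (Fin n) ℂ) :=
  Ideal.span {q | ∃ j : Fin n, (j : ℕ) < k ∧ q = X j ^ d - X l ^ d}

theorem pow_sub_pow_eq_prod_nthRootsFinset_complex {A : Type*} [CommRing A] [IsDomain A]
    [Algebra ℂ A] {d : ℕ} (hd : 0 < d) (x y : A) :
    x ^ d - y ^ d = ∏ ω ∈ Polynomial.nthRootsFinset d (1 : ℂ), (x - algebraMap ℂ A ω * y) := by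
  classical
  have hinj : Function.Injective (algebraMap ℂ A) := FaithfulSMul.algebraMap_injective ℂ A
  have hζ := Complex.isPrimitiveRoot_exp d hd.ne'
  have hζ' := hζ.map_of_injective hinj
  have himage : (Polynomial.nthRootsFinset d (1 : ℂ)).image (algebraMap ℂ A) =
      Polynomial.nthRootsFinset d (1 : A) := by
    refine Finset.eq_of_subset_of_card_le (fun r hr => ?_) ?_
    · obtain ⟨ω, hω, rfl⟩ := Finset.mem_image.mp hr
      exact Polynomial.map_mem_nthRootsFinset_one hω _
    · rw [Finset.card_image_of_injective _ hinj, hζ.card_nthRootsFinset, hζ'.card_nthRootsFinset]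
  rw [hζ'.pow_sub_pow_eq_prod_sub_mul x y hd, ← himage, Finset.prod_image fun _ _ _ _ h => hinj h]

theorem prod_X_sub_C_image_nthRoots {A σ : Type*} [CommRing A] [IsDomain A] [Algebra ℂ A]
    [DecidableEq A] {d : ℕ} (hd : 0 < d) {y : A} (hy : y ≠ 0) (i : σ) :
    ∏ r ∈ (Polynomial.nthRootsFinset d (1 : ℂ)).image (fun ω => algebraMap ℂ A ω * y),
      ((X i : MvPolynomial σ A) - C r) = X i ^ d - C y ^ d := by
  have hinj : Function.Injective (algebraMap ℂ A) := FaithfulSMul.algebraMap_injective ℂ A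
  rw [Finset.prod_image fun ω _ ω' _ h => hinj (mul_right_cancel₀ hy h),
    pow_sub_pow_eq_prod_nthRootsFinset_complex hd]
  simp [MvPolynomial.algebraMap_apply]

theorem mem_powDiffIdeal_of_rootSubst {n d k : ℕ} (hd : 0 < d) (l : Fin n)
    (h : MvPolynomial (Fin n) ℂ)
    (hh : ∀ ω : Fin n → ℂ, (∀ j, ω j ^ d = 1) → rootSubst l k ω h = 0) :
    h ∈ powDiffIdeal l d k := by
  classical
  let R := MvPolynomial (Fin n) ℂ
  let S : Finset R := (Polynomial.nthRootsFinset d (1 : ℂ)).image fun ω => algebraMap ℂ R ω * X l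
  let H : MvPolynomial (Fin n) R := aeval (fun j : Fin n => if (j : ℕ) < k then X j else C (X j)) h
  let back : MvPolynomial (Fin n) R →ₐ[R] R := aeval fun j : Fin n => if (j : ℕ) < k then X j else X l
  have hback : back H = h := by
    have : (back.restrictScalars ℂ).comp
        (aeval (fun j : Fin n => if (j : ℕ) < k then X j else C (X j))) = AlgHom.id ℂ R := by
      ext j
      by_cases hj : (j : ℕ) < k <;> simp [back, hj, R]
    exact DFunLike.congr_fun this h
  obtain ⟨q, -, hq⟩ := combinatorial_nullstellensatz_exists_linearCombination (fun _ => S)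
    (fun _ => ⟨X l, Finset.mem_image.mpr
      ⟨1, (Polynomial.mem_nthRootsFinset hd 1).mpr (one_pow d), by simp⟩⟩) H (by
      intro x hx
      choose ω hω hωx using fun j => Finset.mem_image.mp (hx j)
      rw [← hh ω fun j => (Polynomial.mem_nthRootsFinset hd 1).mp (hω j)]
      have : ((aeval x : MvPolynomial (Fin n) R →ₐ[R] R).restrictScalars ℂ).comp
        (aeval (fun j : Fin n => if (j : ℕ) < k then X j else C (X j))) = rootSubst l k ω := by
        ext1 j
        by_cases hj : (j : ℕ) < k
        · simp only [AlgHom.comp_apply, aeval_X, if_pos hj, AlgHom.restrictScalars_apply, ← hωx]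
          exact ((rootSubst_X l k ω j).trans (if_pos hj)).symm
        · simp only [AlgHom.comp_apply, aeval_X, if_neg hj, AlgHom.restrictScalars_apply]
          exact (aeval_C _ _).trans ((rootSubst_X l k ω j).trans (if_neg hj)).symm
      rw [← this]
      rfl)
  rw [← hback, hq, Finsupp.linearCombination_apply, Finsupp.sum, map_sum]
  refine Ideal.sum_mem _ fun j _ => ?_
  rw [smul_eq_mul, map_mul, prod_X_sub_C_image_nthRoots hd (X_ne_zero l)]
  refine Ideal.mul_mem_left _ _ ?_
  by_cases hj : (j : ℕ) < k
  · exact Ideal.subset_span ⟨j, hj, by simp [back, hj]⟩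
  · simp [back, hj]

theorem rootSubst_eq_zero_of_mem {n d k : ℕ} (l : Fin n) (hk : k ≤ l) {ω : Fin n → ℂ}
    (hω : ∀ j, ω j ^ d = 1) {h : MvPolynomial (Fin n) ℂ} (hh : h ∈ powDiffIdeal l d k) :
    rootSubst l k ω h = 0 := by
  suffices powDiffIdeal l d k ≤ RingHom.ker (rootSubst l k ω) from this hh
  refine Ideal.span_le.mpr ?_
  rintro _ ⟨j, hj, rfl⟩
  rw [SetLike.mem_coe, RingHom.mem_ker, map_sub, map_pow, map_pow, rootSubst_X, rootSubst_X, if_pos hj,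
    if_neg hk.not_gt, mul_pow, ← map_pow, hω, map_one, one_mul, sub_self]

theorem mem_powDiffIdeal_of_mul_mem {n d k : ℕ} (hd : 0 < d) (l : Fin n) (hk : k ≤ l)
    {u : MvPolynomial (Fin n) ℂ}
    (hu : ∀ ω : Fin n → ℂ, (∀ j, ω j ^ d = 1) → rootSubst l k ω u ≠ 0)
    {h : MvPolynomial (Fin n) ℂ} (hh : h * u ∈ powDiffIdeal l d k) :
    h ∈ powDiffIdeal l d k := by
  refine mem_powDiffIdeal_of_rootSubst hd l h fun ω hω => ?_
  have := rootSubst_eq_zero_of_mem l hk hω hh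
  rw [map_mul] at this
  exact (mul_eq_zero.mp this).resolve_right (hu ω hω)

theorem length_powDiffSeq (n d : ℕ) : (powDiffSeq n d).length = n - 1 := by
  simp [powDiffSeq]

theorem span_take_powDiffSeq {n d k : ℕ} (l : Fin n) (hl : (l : ℕ) = n - 1) (hk : k ≤ n - 1)
    (f : MvPolynomial (Fin n) ℂ) :
    Ideal.span {q | q ∈ (powDiffSeq n d ++ [f]).take k} = powDiffIdeal l d k := by
  have hl' : ∀ h, (⟨n - 1, h⟩ : Fin n) = l := fun h => Fin.ext hl.symm
  rw [powDiffIdeal]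
  congr 1
  ext q
  rw [List.take_append_of_le_length (by rw [length_powDiffSeq]; exact hk)]
  simp only [Set.mem_ofPred_eq, List.mem_take_iff_getElem, length_powDiffSeq]
  constructor
  · rintro ⟨i, hi, rfl⟩
    have := (lt_min_iff.mp hi)
    exact ⟨⟨i, by omega⟩, this.1, by simp [powDiffSeq, hl']⟩
  · rintro ⟨j, hj, rfl⟩
    exact ⟨j, lt_min hj (by omega), by simp [powDiffSeq, hl']⟩

theorem regSeq_powDiffSeq_append_iff {n d : ℕ} (hd : 0 < d) (l : Fin n) (hl : (l : ℕ) = n - 1)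
    (f : MvPolynomial (Fin n) ℂ) :
    RegSeq (powDiffSeq n d ++ [f]) ↔
      ∀ g, g * f ∈ powDiffIdeal l d (n - 1) → g ∈ powDiffIdeal l d (n - 1) := by
  have hl' : ∀ h, (⟨n - 1, h⟩ : Fin n) = l := fun h => Fin.ext hl.symm
  constructor
  · intro h g hg
    have := h ⟨n - 1, by simp [length_powDiffSeq]⟩ g
    simp only [span_take_powDiffSeq l hl le_rfl] at this
    apply this
    convert hg using 2
    simp [length_powDiffSeq]
  · rintro h ⟨i, hi⟩ g hg
    have hi' : i ≤ n - 1 := by simp [length_powDiffSeq] at hi; omega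
    simp only [span_take_powDiffSeq l hl hi'] at hg ⊢
    rcases hi'.lt_or_eq with hlt | rfl
    · refine mem_powDiffIdeal_of_mul_mem hd l (hl ▸ hi') (u := X ⟨i, by omega⟩ ^ d - X l ^ d)
        (fun ω hω h0 => ?_) ?_
      · have hil : (⟨i, by omega⟩ : Fin n) ≠ l := fun e => by
          have := congrArg Fin.val e
          simp at this; omega
        have := congrArg (eval fun j => if j = l then (1 : ℂ) else 0) h0
        simp [hl, hi'.not_gt, hil, hd.ne'] at this
      · convert hg using 2
        rw [List.get_eq_getElem, List.getElem_append_left (by simpa [length_powDiffSeq] using hlt)]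
        simp [powDiffSeq, hl']
    · apply h
      convert hg using 2
      simp [length_powDiffSeq]

theorem rootSubst_of_isHomogeneous {n a : ℕ} (l : Fin n) (hl : (l : ℕ) = n - 1)
    {f : MvPolynomial (Fin n) ℂ} (hf : f.IsHomogeneous a) (z : Fin n → ℂ) (hz : z l = 1) :
    rootSubst l (n - 1) z f = X l ^ a * C (eval z f) := by
  have : rootSubst l (n - 1) z = aeval fun j => X l * C (z j) := by
    ext1 j
    by_cases hj : (j : ℕ) < n - 1
    · simp [hj, mul_comm]
    · obtain rfl : j = l := Fin.ext (by omega)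
      simp [hj, hz]
  rw [this, hf.aeval_mul_left]
  congr 1
  have : (aeval fun j => C (z j)) = (Algebra.ofId ℂ (MvPolynomial (Fin n) ℂ)).comp (aeval z) := by
    ext1 j
    simp [Algebra.ofId_apply]
  rw [this]
  simp [Algebra.ofId_apply, aeval_eq_eval]

theorem regSeq_iff_eval_ne_zero {n d a : ℕ} (hn : 2 ≤ n) (hd : 0 < d)
    {f : MvPolynomial (Fin n) ℂ} (hf : f.IsHomogeneous a) :
    RegSeq (powDiffSeq n d ++ [f]) ↔ ∀ z ∈ Vset n d, eval z f ≠ 0 := by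
  classical
  let l : Fin n := ⟨n - 1, by omega⟩
  have hl : (l : ℕ) = n - 1 := rfl
  rw [regSeq_powDiffSeq_append_iff hd l hl]
  constructor
  · rintro h z ⟨hz, hzl⟩ h0
    let q : MvPolynomial (Fin n) ℂ := ∏ j, ∏ ω ∈ (Polynomial.nthRootsFinset d (1 : ℂ)).erase (z j),
      (X j - C ω * X l)
    have hzl := hzl l hl
    have hq : q ∈ powDiffIdeal l d (n - 1) := by
      apply h
      refine mem_powDiffIdeal_of_rootSubst hd l _ fun ω hω => ?_
      by_cases hωz : ∀ j : Fin n, (j : ℕ) < n - 1 → ω j = z j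
      · have : rootSubst l (n - 1) ω = rootSubst l (n - 1) z := by
          ext1 j
          by_cases hj : (j : ℕ) < n - 1
          · simp [hj, hωz j hj]
          · simp [hj]
        rw [map_mul, this, rootSubst_of_isHomogeneous l hl hf z hzl, h0, C_0, mul_zero, mul_zero]
      · push Not at hωz
        obtain ⟨j, hj, hne⟩ := hωz
        have hmem : ω j ∈ (Polynomial.nthRootsFinset d (1 : ℂ)).erase (z j) :=
          Finset.mem_erase.mpr ⟨hne, (Polynomial.mem_nthRootsFinset hd 1).mpr (hω j)⟩
        rw [map_mul, map_prod, Finset.prod_eq_zero (Finset.mem_univ j), zero_mul]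
        rw [map_prod, Finset.prod_eq_zero hmem]
        simp [hj, hl]
    have := rootSubst_eq_zero_of_mem l le_rfl hz hq
    have := congrArg (eval z) this
    have hsubst : eval z (rootSubst l (n - 1) z q) = eval z q := by
      rw [rootSubst, ← aeval_eq_eval, ← AlgHom.comp_apply, comp_aeval]
      congr 2
      ext j
      split_ifs <;> simp [hzl]
    rw [hsubst, map_zero, map_prod, Finset.prod_eq_zero_iff] at this
    obtain ⟨j, -, hj⟩ := this
    rw [map_prod, Finset.prod_eq_zero_iff] at hj
    obtain ⟨ω, hω, h0⟩ := hj
    refine Finset.ne_of_mem_erase hω ?_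
    simpa [hzl, sub_eq_zero, eq_comm] using h0
  · intro h g hg
    refine mem_powDiffIdeal_of_mul_mem hd l le_rfl (fun ω hω => ?_) hg
    have : rootSubst l (n - 1) ω = rootSubst l (n - 1) (Function.update ω l 1) := by
      ext1 j
      by_cases hj : (j : ℕ) < n - 1
      · have hjl : j ≠ l := fun e => by simp [e, hl] at hj
        simp [hj, hjl]
      · simp [hj]
    rw [this, rootSubst_of_isHomogeneous l hl hf _ (by simp)]
    refine mul_ne_zero (pow_ne_zero _ (X_ne_zero l)) (C_ne_zero.mpr (h _ ⟨fun j => ?_, fun j hj => ?_⟩))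
    · by_cases hj : j = l
      · simp [hj]
      · simp [hj, hω]
    · obtain rfl : j = l := Fin.ext hj
      simp

theorem IsSymPoint.card_fiber_mul {n p : ℕ} (hp : p.Prime) {z : Fin n → ℂ} (h : IsSymPoint p z)
    {c : ℂ} (hc : c ^ p = 1) (w : ℂ) :
    Finset.card {i | z i = c * w} = Finset.card {i | z i = w} := by
  by_cases h1 : c = 1
  · simp [h1]
  have := Fact.mk hp
  have hprim : IsPrimitiveRoot c p := orderOf_eq_prime hc h1 ▸ IsPrimitiveRoot.orderOf c
  obtain ⟨τ, hτ⟩ := h c hprim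
  refine (Finset.card_equiv τ fun i => ?_).symm
  simp [← hτ, hprim.ne_zero hp.ne_zero]

theorem card_fiber_pow {n v : ℕ} (hv : 0 < v) {z : Fin n → ℂ}
    (hinv : ∀ c : ℂ, c ^ v = 1 → ∀ w,
      Finset.card {i | z i = c * w} = Finset.card {i | z i = w})
    {w : ℂ} (hw : w ≠ 0) :
    Finset.card {i | z i ^ v = w ^ v} = v * Finset.card {i | z i = w} := by
  have hmaps : ∀ i ∈ ({i | z i ^ v = w ^ v} : Finset (Fin n)),
      z i / w ∈ Polynomial.nthRootsFinset v (1 : ℂ) := by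
    intro i hi
    rw [Polynomial.mem_nthRootsFinset hv, div_pow, (Finset.mem_filter.mp hi).2,
      div_self (pow_ne_zero _ hw)]
  rw [Finset.card_eq_sum_card_fiberwise hmaps, Finset.sum_congr rfl (g := fun _ =>
    Finset.card {i | z i = w}), Finset.sum_const, smul_eq_mul,
    (Complex.isPrimitiveRoot_exp v hv.ne').card_nthRootsFinset]
  intro c hc
  rw [Polynomial.mem_nthRootsFinset hv] at hc
  rw [← hinv c hc w, Finset.filter_filter]
  congr 1
  ext i
  simp only [Finset.mem_filter, Finset.mem_univ, true_and, div_eq_iff hw]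
  exact ⟨fun h => h.2, fun h => ⟨by rw [h, mul_pow, hc, one_mul], h⟩⟩

theorem dvd_gcd_of_card_fiber_mul {n d v : ℕ} (hd : 0 < d) (hv : 0 < v) {z : Fin n → ℂ}
    (hz : ∀ i, z i ^ d = 1) (i₀ : Fin n) (hz₀ : z i₀ = 1)
    (hinv : ∀ c : ℂ, c ^ v = 1 → ∀ w,
      Finset.card {i | z i = c * w} = Finset.card {i | z i = w}) :
    v ∣ Nat.gcd d n := by
  have hne : ∀ i, z i ≠ 0 := fun i h => by simpa [h, hd.ne'] using hz i
  refine Nat.dvd_gcd ?_ ?_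
  · have hζ := Complex.isPrimitiveRoot_exp v hv.ne'
    have hcard := hinv _ hζ.pow_eq_one 1
    have hpos : 0 < Finset.card {i | z i = 1} :=
      Finset.card_pos.mpr ⟨i₀, by simpa using hz₀⟩
    rw [← hcard, Finset.card_pos] at hpos
    obtain ⟨i, hi⟩ := hpos
    rw [Finset.mem_filter, mul_one] at hi
    exact hζ.dvd_of_pow_eq_one d (hi.2 ▸ hz i)
  · have hsum := Finset.card_eq_sum_card_image (fun i => z i ^ v) Finset.univ
    rw [Finset.card_univ, Fintype.card_fin] at hsum
    rw [hsum]
    refine Finset.dvd_sum fun u hu => ?_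
    obtain ⟨i, -, rfl⟩ := Finset.mem_image.mp hu
    exact ⟨_, card_fiber_pow hv hinv (hne i)⟩

theorem exists_dvd_gcd_sum_pow_ne_zero {n d p : ℕ} (hn : 2 ≤ n) (hd : 0 < d) (hp : p.Prime)
    (hsym : ∀ z ∈ Vset n d, ∑ i, z i = 0 → IsSymPoint p z) {z : Fin n → ℂ} (hz : z ∈ Vset n d) :
    ∃ k, k ∣ Nat.gcd d n ∧ ∑ i, z i ^ k ≠ 0 := by
  by_contra! hcon
  have hne : ∀ i, z i ≠ 0 := fun i h => by simpa [h, hd.ne'] using hz.1 i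
  have hdvd : ∀ v, 0 < v → (∀ c : ℂ, c ^ v = 1 → ∀ w,
      Finset.card {i | z i = c * w} = Finset.card {i | z i = w}) → v ∣ Nat.gcd d n :=
    fun v hv => dvd_gcd_of_card_fiber_mul hd hv hz.1 ⟨n - 1, by omega⟩ (hz.2 _ rfl)
  have hinv : ∀ j : ℕ, ∀ c : ℂ, c ^ p ^ j = 1 → ∀ w,
      Finset.card {i | z i = c * w} = Finset.card {i | z i = w} := by
    intro j
    induction j with
    | zero =>
      intro c hc w
      simp [show c = 1 by simpa using hc]
    | succ j ih =>
      intro c hc w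
      have hv : 0 < p ^ j := pow_pos hp.pos j
      rcases eq_or_ne w 0 with rfl | hw
      · simp
      have hc0 : c ≠ 0 := fun h => by simp [h, hp.ne_zero] at hc
      have hpow : IsSymPoint p fun i => z i ^ p ^ j := by
        refine hsym _ ⟨fun i => ?_, fun i hi => ?_⟩ (hcon _ (hdvd _ hv ih))
        · rw [pow_right_comm, hz.1, one_pow]
        · simp [hz.2 i hi]
      have key := hpow.card_fiber_mul hp (c := c ^ p ^ j) (by rw [← pow_mul, ← pow_succ, hc])
        (w ^ p ^ j)
      rw [← mul_pow, card_fiber_pow hv ih (mul_ne_zero hc0 hw), card_fiber_pow hv ih hw] at key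
      exact Nat.eq_of_mul_eq_mul_left hv key
  have := Nat.le_of_dvd hd
    ((hdvd (p ^ d) (pow_pos hp.pos d) (hinv d)).trans (Nat.gcd_dvd_left d n))
  exact (Nat.lt_pow_self hp.one_lt).not_ge this

theorem Vset_finite {n d : ℕ} (hd : 0 < d) : (Vset n d).Finite := by
  refine (Set.Finite.pi fun _ : Fin n =>
    (Polynomial.nthRootsFinset d (1 : ℂ)).finite_toSet).subset ?_
  intro z hz i _
  simpa [Polynomial.mem_nthRootsFinset hd] using hz.1 i

theorem isHomogeneous_psum {σ R : Type*} [Fintype σ] [CommSemiring R] (k : ℕ) :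
    (psum σ R k).IsHomogeneous k :=
  IsHomogeneous.sum _ _ _ fun i _ => isHomogeneous_X_pow i k

theorem gcd_dvd_of_goodTriple {n d a : ℕ} (hn : 2 ≤ n) (hd : 0 < d) (h : GoodTriple n d a) :
    Nat.gcd d n ∣ a := by
  obtain ⟨f, hf, hfs, hreg⟩ := h
  rw [regSeq_iff_eval_ne_zero hn hd hf] at hreg
  obtain ⟨m, rfl⟩ : ∃ m, n = m + 1 := ⟨n - 1, by omega⟩
  have hg : Nat.gcd d (m + 1) ≠ 0 := (Nat.gcd_pos_of_pos_left _ hd).ne'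
  obtain ⟨ζ, hζ⟩ : ∃ ζ : ℂ, IsPrimitiveRoot ζ (Nat.gcd d (m + 1)) :=
    ⟨_, Complex.isPrimitiveRoot_exp _ hg⟩
  have hζn : ζ ^ (m + 1) = 1 := (hζ.pow_eq_one_iff_dvd _).mpr (Nat.gcd_dvd_right _ _)
  have hζd : ζ ^ d = 1 := (hζ.pow_eq_one_iff_dvd _).mpr (Nat.gcd_dvd_left _ _)
  let z : Fin (m + 1) → ℂ := fun i => ζ ^ ((i : ℕ) + 1)
  have hz : z ∈ Vset (m + 1) d := by
    refine ⟨fun i => ?_, fun i hi => ?_⟩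
    · simp only [z]
      rw [pow_right_comm, hζd, one_pow]
    · simp only [z, hi]
      simpa using hζn
  have hrot : (fun i => ζ * z i) = z ∘ finRotate (m + 1) := by
    funext i
    rcases eq_or_ne i (Fin.last m) with rfl | hi
    · simp [z, hζn]
    · simp only [z, Function.comp_apply, coe_finRotate_of_ne_last hi, pow_succ']
  have h1 : ζ ^ a * eval z f = eval z f := by
    have := hf.aeval_mul_left ζ z
    rw [hrot, ← aeval_rename, hfs] at this
    simpa [aeval_eq_eval] using this.symm
  exact (hζ.pow_eq_one_iff_dvd a).mp (mul_right_cancel₀ (hreg z hz) (h1.trans (one_mul _).symm))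

theorem goodTriple_of_sum_pow_ne_zero {n d a : ℕ} (hn : 2 ≤ n) (hd : 0 < d)
    (h : ∀ z ∈ Vset n d, ∃ k, k ∣ a ∧ ∑ i, z i ^ k ≠ 0) : GoodTriple n d a := by
  have : Finite (Vset n d) := Vset_finite hd
  obtain ⟨f, ⟨hf, hfs⟩, hne⟩ := Module.Dual.exists_forall_mem_ne_zero_of_forall_exists
    (homogeneousSubmodule (Fin n) ℂ a ⊓ (symmetricSubalgebra (Fin n) ℂ).toSubmodule)
    (fun z : Vset n d => (aeval (R := ℂ) z.1).toLinearMap) (by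
      rintro ⟨z, hz⟩
      obtain ⟨k, ⟨b, rfl⟩, hk⟩ := h z hz
      refine ⟨psum (Fin n) ℂ k ^ b, ⟨(isHomogeneous_psum k).pow b,
        (symmetricSubalgebra (Fin n) ℂ).pow_mem (psum_isSymmetric (Fin n) ℂ k) b⟩, ?_⟩
      simpa [psum] using pow_ne_zero b hk)
  refine ⟨f, hf, hfs, (regSeq_iff_eval_ne_zero hn hd hf).mpr fun z hz => ?_⟩
  simpa [aeval_eq_eval] using hne ⟨z, hz⟩

theorem symmetric_case (n d a p : ℕ) (hn : 2 ≤ n) (hd : 0 < d) (ha : 0 < a)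
    (hp : p.Prime)
    (hsym : ∀ z ∈ Vset n d, ∑ i, z i = 0 → IsSymPoint p z)
    (hpg : p ∣ Nat.gcd d n) :
    (¬ GoodTriple n d a) ↔ ¬ Nat.gcd d n ∣ a := by
  refine not_congr ⟨gcd_dvd_of_goodTriple hn hd, fun hga => ?_⟩
  refine goodTriple_of_sum_pow_ne_zero hn hd fun z hz => ?_
  obtain ⟨k, hk, hne⟩ := exists_dvd_gcd_sum_pow_ne_zero hn hd hp hsym hz
  exact ⟨k, hk.trans hga, hne⟩
end
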